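/- arXiv:1308.3639 — 5 statements merged into one kernel-verified Lean document; each statement's English description precedes it below -/
import Mathlib

section
/- If F : ℝ^d → (nonempty compact convex subsets of ℝ^d) is upper semicontinuous and relaxed one-sided Lipschitz with constant l < 0, then the inclusion 0 ∈ F(x) has a solution x̄ with |x̄| ≤ -(1/l)·dist(0, F(0)). -/
open Metric Filter RealInnerProductSpace

theorem descent_aux {E : Type*} [NormedAddCommGroup E] [InnerProductSpace ℝ E]
    [FiniteDimensional ℝ E] (u0 : E) (hu0 : ‖u0‖ = 1)
    (S : E → E → ℝ) (R K lam c rho : ℝ)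
    (hsub : ∀ v w x, S (v + w) x ≤ S v x + S w x)
    (hhom : ∀ a : ℝ, 0 ≤ a → ∀ v x, S (a • v) x = a * S v x)
    (hLX : ∀ v x x', ‖v‖ = 1 → ‖x‖ ≤ R → ‖x'‖ ≤ R → S v x ≤ S v x' + K * ‖x - x'‖)
    (hLV : ∀ v x, ‖x‖ ≤ R → S v x ≤ K * ‖v‖)
    (hro : ∀ v x t, ‖v‖ = 1 → 0 < t → S v x + lam * t ≤ S v (x - t • v))
    (h0 : ∀ v, ‖v‖ = 1 → -rho ≤ S v 0)
    (hK : 0 < K) (hc : 0 < c) (hcl : c < lam) (hrho : 0 ≤ rho) (hR : rho / c < R) :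
    ∃ x, ‖x‖ ≤ rho / c ∧ ∀ v, ‖v‖ = 1 → 0 ≤ S v x := by
  have : ProperSpace E := FiniteDimensional.proper ℝ E
  have hRpos : 0 < R := lt_of_le_of_lt (by positivity) hR
  have hScont : ∀ x, ‖x‖ ≤ R → Continuous (fun v => S v x) := by
    intro x hx
    refine (LipschitzWith.of_le_add_mul (Real.toNNReal K) ?_).continuous
    intro v w
    have h1 := hsub w (v - w) x
    have h2 := hLV (v - w) x hx
    rw [add_sub_cancel] at h1
    rw [Real.coe_toNNReal _ hK.le, dist_eq_norm]
    linarith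
  have hmin : ∀ x, ∃ V : E, ‖x‖ ≤ R → ‖V‖ = 1 ∧ ∀ v, ‖v‖ = 1 → S V x ≤ S v x := by
    intro x
    by_cases hx : ‖x‖ ≤ R
    · obtain ⟨V, hV, hm⟩ := (isCompact_sphere (0 : E) 1).exists_isMinOn
        ⟨u0, by simpa using hu0⟩ (hScont x hx).continuousOn
      refine ⟨V, fun _ => ⟨by simpa using hV, fun v hv => ?_⟩⟩
      exact hm (by simpa using hv)
    · exact ⟨0, fun h => absurd h hx⟩
  choose V hV using hmin
  have hmLip : ∀ x x', ‖x‖ ≤ R → ‖x'‖ ≤ R → S (V x) x ≤ S (V x') x' + K * ‖x - x'‖ := by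
    intro x x' hx hx'
    have h1 := (hV x hx).2 (V x') (hV x' hx').1
    have h2 := hLX (V x') x x' (hV x' hx').1 hx hx'
    linarith
  have hmc : ContinuousOn (fun x => S (V x) x) (closedBall (0 : E) R) := by
    refine (LipschitzOnWith.of_le_add_mul (Real.toNNReal K) ?_).continuousOn
    intro x hx y hy
    rw [Real.coe_toNNReal _ hK.le, dist_eq_norm]
    exact hmLip x y (by simpa using hx) (by simpa using hy)
  have hnc : ContinuousOn (fun x => min (S (V x) x) 0 - c * ‖x‖) (closedBall (0 : E) R) :=
    (ContinuousOn.inf hmc continuousOn_const).sub (by fun_prop)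
  obtain ⟨x, hxR, hmax⟩ := (isCompact_closedBall (0 : E) R).exists_isMaxOn
    ⟨0, by simpa using hRpos.le⟩ hnc
  have hxR' : ‖x‖ ≤ R := by simpa using hxR
  have hmax' : ∀ y, ‖y‖ ≤ R → min (S (V y) y) 0 - c * ‖y‖ ≤ min (S (V x) x) 0 - c * ‖x‖ :=
    fun y hy => hmax (by simpa using hy)
  have h00 : -rho ≤ min (S (V x) x) 0 - c * ‖x‖ := by
    have h1 := hmax' 0 (by simpa using hRpos.le)
    have h2 := h0 (V 0) (hV 0 (by simpa using hRpos.le)).1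
    have h3 : -rho ≤ min (S (V 0) 0) 0 := le_min h2 (by linarith)
    simp only [norm_zero, mul_zero, sub_zero] at h1
    linarith
  have hxn : ‖x‖ ≤ rho / c := by
    rw [le_div_iff₀ hc]
    have := min_le_right (S (V x) x) 0
    linarith
  obtain ⟨hV1, hVmin⟩ := hV x hxR'
  refine ⟨x, hxn, ?_⟩
  by_contra! hcon
  obtain ⟨w, hw, hwneg⟩ := hcon
  have hneg : S (V x) x < 0 := lt_of_le_of_lt (hVmin w hw) hwneg
  set m := S (V x) x with hm
  -- uniqueness
  have huniq : ∀ v, ‖v‖ = 1 → v ≠ V x → m < S v x := by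
    intro v hv hne
    by_contra! hle
    have h1 := hsub v (V x) x
    have hlt : ‖v + V x‖ < 2 := by
      have hp := parallelogram_law_with_norm ℝ v (V x)
      have hpos : 0 < ‖v - V x‖ := norm_pos_iff.mpr (sub_ne_zero.mpr hne)
      rw [hv, hV1] at hp
      nlinarith [norm_nonneg (v + V x)]
    rcases (norm_nonneg (v + V x)).eq_or_lt with h | h
    · have h2 : v + V x = 0 := norm_eq_zero.mp h.symm
      have h3 := hhom 0 le_rfl 0 x
      rw [zero_smul, zero_mul] at h3
      rw [h2, h3] at h1
      linarith
    · have h2 := hVmin (‖v + V x‖⁻¹ • (v + V x)) (by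
        rw [norm_smul, norm_inv, norm_norm, inv_mul_cancel₀ h.ne'])
      rw [hhom _ (by positivity)] at h2
      rw [inv_mul_eq_div, le_div_iff₀ h] at h2
      nlinarith
  obtain ⟨th, hth, hKth⟩ : ∃ th > 0, K * th < lam - c := by
    refine ⟨(lam - c) / (2 * K), div_pos (by linarith) (by positivity), ?_⟩
    have : K * ((lam - c) / (2 * K)) = (lam - c) / 2 := by field_simp
    rw [this]; linarith
  obtain ⟨eta, heta, hgap⟩ : ∃ eta > 0, ∀ v, ‖v‖ = 1 → th ≤ ‖v - V x‖ → m + eta ≤ S v x := by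
    have hcpt : IsCompact (sphere (0 : E) 1 ∩ {v | th ≤ ‖v - V x‖}) :=
      (isCompact_sphere _ _).inter_right (isClosed_le continuous_const (by fun_prop))
    rcases (sphere (0 : E) 1 ∩ {v | th ≤ ‖v - V x‖}).eq_empty_or_nonempty with he | he
    · refine ⟨1, one_pos, fun v hv hv2 => ?_⟩
      have : v ∈ sphere (0 : E) 1 ∩ {v | th ≤ ‖v - V x‖} := ⟨by simpa using hv, hv2⟩
      rw [he] at this
      exact this.elim
    · obtain ⟨q, hq, hqm⟩ := hcpt.exists_isMinOn he (hScont x hxR').continuousOn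
      have hqne : q ≠ V x := by
        rintro rfl
        have := hq.2
        simp at this
        linarith
      have := huniq q (by simpa using hq.1) hqne
      refine ⟨S q x - m, by linarith, fun v hv hv2 => ?_⟩
      have h4 : S q x ≤ S v x := hqm ⟨by simpa using hv, hv2⟩
      linarith
  -- step
  obtain ⟨t, ht, ht1, ht2, ht3⟩ : ∃ t > 0, t ≤ R - rho / c ∧ m + c * t < 0 ∧
      (K + c) * t < eta := by
    have e1 : ∀ᶠ t in nhdsWithin (0 : ℝ) (Set.Ioi 0), t < R - rho / c :=
      nhdsWithin_le_nhds ((continuous_id).continuousAt.eventually_lt continuousAt_const (by simpa using hR))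
    have e2 : ∀ᶠ t in nhdsWithin (0 : ℝ) (Set.Ioi 0), m + c * t < 0 :=
      nhdsWithin_le_nhds (ContinuousAt.eventually_lt (f := fun t => m + c * t) (by fun_prop) continuousAt_const (by simpa using hneg))
    have e3 : ∀ᶠ t in nhdsWithin (0 : ℝ) (Set.Ioi 0), (K + c) * t < eta :=
      nhdsWithin_le_nhds (ContinuousAt.eventually_lt (f := fun t => (K + c) * t) (by fun_prop) continuousAt_const (by simpa using heta))
    obtain ⟨t, a, b, d, e⟩ := (e1.and (e2.and (e3.and self_mem_nhdsWithin))).exists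
    exact ⟨t, e, a.le, b, d⟩
  have hstep : ∀ v : E, ‖v‖ = 1 → ‖x - t • v‖ ≤ ‖x‖ + t := by
    intro v hv
    have := norm_sub_le x (t • v)
    rwa [norm_smul, hv, Real.norm_of_nonneg ht.le, mul_one] at this
  set x1 := x - t • V x with hx1
  have hx1R : ‖x1‖ ≤ R := by have := hstep _ hV1; linarith
  obtain ⟨hW1, hWmin⟩ := hV x1 hx1R
  have hup : S (V x1) x1 ≤ m + c * t := by
    have h1 := hmax' x1 hx1R
    have h2 := hstep _ hV1
    rw [min_eq_left hneg.le] at h1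
    have h3 : c * ‖x1‖ ≤ c * (‖x‖ + t) := by gcongr
    have h4 : min (S (V x1) x1) 0 ≤ m + c * t := by linarith
    rcases min_le_iff.mp h4 with h | h
    · exact h
    · linarith
  rcases le_or_gt th ‖V x1 - V x‖ with hge | hlt
  · have h1 := hgap _ hW1 hge
    have h2 := hLX (V x1) x x1 hW1 hxR' hx1R
    have h3 : ‖x - x1‖ = t := by
      rw [hx1, sub_sub_cancel, norm_smul, hV1, Real.norm_of_nonneg ht.le, mul_one]
    rw [h3] at h2
    nlinarith
  · have h1 := hro (V x1) x t hW1 ht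
    have h2 := hLX (V x1) (x - t • V x1) x1 hW1 (by have := hstep _ hW1; linarith) hx1R
    have h3 : ‖x - t • V x1 - x1‖ = t * ‖V x1 - V x‖ := by
      rw [hx1, sub_sub_sub_cancel_left, ← smul_sub, norm_smul, Real.norm_of_nonneg ht.le,
        norm_sub_rev]
    rw [h3] at h2
    have h4 := hVmin _ hW1
    have h5 : t * ‖V x1 - V x‖ ≤ t * th := by gcongr
    have h6 : K * (t * ‖V x1 - V x‖) ≤ K * (t * th) := by gcongr
    nlinarith

theorem bdd_aux {E : Type*} [NormedAddCommGroup E] [ProperSpace E] (F : E → Set E)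
    (hne : ∀ x, (F x).Nonempty) (hcp : ∀ x, IsCompact (F x))
    (husc : ∀ x, ∀ ε > 0, ∃ δ > 0, ∀ x', dist x' x < δ →
      ∀ y ∈ F x', Metric.infDist y (F x) < ε) (R : ℝ) :
    ∃ M > 0, ∀ z, ‖z‖ ≤ R → ∀ y ∈ F z, ‖y‖ ≤ M := by
  have key : ∃ M : ℝ, ∀ z ∈ closedBall (0 : E) R, ∀ y ∈ F z, ‖y‖ ≤ M := by
    refine (isCompact_closedBall (0 : E) R).induction_on
      (p := fun s => ∃ M : ℝ, ∀ z ∈ s, ∀ y ∈ F z, ‖y‖ ≤ M) ?_ ?_ ?_ ?_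
    · exact ⟨0, by simp⟩
    · rintro s t hst ⟨M, hM⟩
      exact ⟨M, fun z hz => hM z (hst hz)⟩
    · rintro s t ⟨M, hM⟩ ⟨N, hN⟩
      refine ⟨max M N, fun z hz y hy => ?_⟩
      rcases hz with h | h
      · exact (hM z h y hy).trans (le_max_left _ _)
      · exact (hN z h y hy).trans (le_max_right _ _)
    · intro x _
      obtain ⟨δ, hδ, h⟩ := husc x 1 one_pos
      obtain ⟨N, hN⟩ := (hcp x).isBounded.exists_norm_le
      refine ⟨ball x δ, mem_nhdsWithin_of_mem_nhds (ball_mem_nhds x hδ), N + 1, ?_⟩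
      intro z hz y hy
      obtain ⟨y0, hy0, hd⟩ := (infDist_lt_iff (hne x)).mp (h z hz y hy)
      have h1 := hN y0 hy0
      rw [dist_eq_norm] at hd
      have := norm_le_norm_add_norm_sub' y y0
      linarith
  obtain ⟨M, hM⟩ := key
  exact ⟨max M 1, by positivity, fun z hz y hy =>
    (hM z (by simpa using hz) y hy).trans (le_max_left _ _)⟩

/-- the sup of the support function over the ball -/
noncomputable def hsup {E : Type*} [NormedAddCommGroup E] [InnerProductSpace ℝ E]
    (F : E → Set E) (v x : E) (r : ℝ) : ℝ :=
  sSup {a : ℝ | ∃ z y, ‖z - x‖ ≤ r ∧ y ∈ F z ∧ a = ⟪y, v⟫}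

section
variable {E : Type*} [NormedAddCommGroup E] [InnerProductSpace ℝ E] (F : E → Set E)
    (hne : ∀ x, (F x).Nonempty)
    (hb : ∀ R : ℝ, ∃ M > 0, ∀ z, ‖z‖ ≤ R → ∀ y ∈ F z, ‖y‖ ≤ M)

include hb in
theorem le_hsup (v x z y : E) (r : ℝ) (hz : ‖z - x‖ ≤ r) (hy : y ∈ F z) :
    ⟪y, v⟫ ≤ hsup F v x r := by
  refine le_csSup ?_ ⟨z, y, hz, hy, rfl⟩
  obtain ⟨M, hM, h⟩ := hb (‖x‖ + r)
  refine ⟨M * ‖v‖, ?_⟩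
  rintro a ⟨z, y, hz, hy, rfl⟩
  have h1 := h z (by have := norm_le_norm_add_norm_sub' z x; linarith) y hy
  have h2 := real_inner_le_norm y v
  exact h2.trans (by gcongr)

include hne in
theorem hsup_le (v x : E) (r B : ℝ) (hr : 0 ≤ r)
    (h : ∀ z y, ‖z - x‖ ≤ r → y ∈ F z → ⟪y, v⟫ ≤ B) : hsup F v x r ≤ B := by
  obtain ⟨y, hy⟩ := hne x
  refine csSup_le ⟨_, x, y, by simpa using hr, hy, rfl⟩ ?_
  rintro a ⟨z, y, hz, hy, rfl⟩
  exact h z y hz hy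

include hne hb in
theorem hsup_mono (v x : E) : MonotoneOn (hsup F v x) (Set.Ici 0) := by
  intro r hr s hs hrs
  exact hsup_le F hne v x r _ hr fun z y hz hy => le_hsup F hb v x z y s (hz.trans hrs) hy

include hne hb in
theorem hsup_int (v x : E) (a b : ℝ) (ha : 0 ≤ a) (hb' : 0 ≤ b) :
    IntervalIntegrable (hsup F v x) MeasureTheory.volume a b := by
  apply MonotoneOn.intervalIntegrable
  refine (hsup_mono F hne hb v x).mono ?_
  intro t ht
  exact (le_min ha hb').trans ht.1

include hne hb in
theorem key_aux [FiniteDimensional ℝ E] (u0 : E) (hu0 : ‖u0‖ = 1)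
    (l : ℝ) (hl : l < 0)
    (hrosl : ∀ x x', ∀ y ∈ F x, ∃ y' ∈ F x',
      ⟪y - y', x - x'⟫ ≤ l * ‖x - x'‖ ^ 2)
    (c e rho : ℝ) (hc : 0 < c) (hcl : c < -l) (he : 0 < e) (hrho : 0 ≤ rho)
    (y0 : E) (hy0 : y0 ∈ F 0) (hy0r : ‖y0‖ ≤ rho) :
    ∃ x, ‖x‖ ≤ rho / c ∧ ∀ v, ‖v‖ = 1 → 0 ≤ hsup F v x e := by
  set R := rho / c + 1 with hR
  have hRpos : 0 < R := by positivity
  obtain ⟨M, hM, hMb⟩ := hb (3 * R + e)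
  have hup : ∀ v x r, ‖x‖ ≤ R → 0 ≤ r → r ≤ 2 * R + e → hsup F v x r ≤ M * ‖v‖ := by
    intro v x r hx hr hr'
    refine hsup_le F hne v x r _ hr fun z y hz hy => ?_
    have h1 := hMb z (by have := norm_le_norm_add_norm_sub' z x; linarith) y hy
    exact (real_inner_le_norm y v).trans (by gcongr)
  have hlo : ∀ v x r, ‖x‖ ≤ R → 0 ≤ r → -(M * ‖v‖) ≤ hsup F v x r := by
    intro v x r hx hr
    obtain ⟨y, hy⟩ := hne x
    have h0 := le_hsup F hb v x x y r (by simpa using hr) hy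
    have h1 := hMb x (by linarith) y hy
    have h2 := abs_real_inner_le_norm y v
    have h3 : ‖y‖ * ‖v‖ ≤ M * ‖v‖ := by gcongr
    have := (abs_le.mp (h2.trans h3)).1
    linarith
  have hint := hsup_int F hne hb
  suffices hD : ∃ x, ‖x‖ ≤ (rho * e) / (c * e) ∧ ∀ v, ‖v‖ = 1 →
      0 ≤ ∫ r in (0:ℝ)..e, hsup F v x r by
    obtain ⟨x, hx, hS⟩ := hD
    rw [mul_div_mul_right _ _ he.ne'] at hx
    refine ⟨x, hx, fun v hv => ?_⟩
    have h1 := hS v hv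
    have h2 : ∫ r in (0:ℝ)..e, hsup F v x r ≤ ∫ r in (0:ℝ)..e, hsup F v x e := by
      refine intervalIntegral.integral_mono_on he.le (hint _ _ _ _ le_rfl he.le) (by simp) ?_
      intro r hr
      exact hsup_mono F hne hb v x hr.1 he.le hr.2
    simp only [intervalIntegral.integral_const, smul_eq_mul, sub_zero] at h2
    exact nonneg_of_mul_nonneg_right (h1.trans h2) he
  refine descent_aux u0 hu0 (fun v x => ∫ r in (0:ℝ)..e, hsup F v x r) R
    (max (2 * M) (M * e)) ((-l) * e) (c * e) (rho * e) ?_ ?_ ?_ ?_ ?_ ?_ (by positivity)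
    (by positivity) (by gcongr) (by positivity) (by rw [mul_div_mul_right _ _ he.ne']; linarith)
  · intro v w x
    try dsimp only
    rw [← intervalIntegral.integral_add (hint _ _ _ _ le_rfl he.le) (hint _ _ _ _ le_rfl he.le)]
    refine intervalIntegral.integral_mono_on he.le (hint _ _ _ _ le_rfl he.le)
      ((hint _ _ _ _ le_rfl he.le).add (hint _ _ _ _ le_rfl he.le)) ?_
    intro r hr
    refine hsup_le F hne _ x r _ hr.1 fun z y hz hy => ?_
    rw [inner_add_right]
    exact add_le_add (le_hsup F hb v x z y r hz hy) (le_hsup F hb w x z y r hz hy)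
  · intro a ha v x
    try dsimp only
    rw [← intervalIntegral.integral_const_mul]
    refine intervalIntegral.integral_congr ?_
    intro r hr
    rw [Set.uIcc_of_le he.le] at hr
    try dsimp only
    refine le_antisymm ?_ ?_
    · refine hsup_le F hne _ x r _ hr.1 fun z y hz hy => ?_
      rw [real_inner_smul_right]
      exact mul_le_mul_of_nonneg_left (le_hsup F hb v x z y r hz hy) ha
    · rcases ha.eq_or_lt with h | h
      · obtain ⟨y, hy⟩ := hne x
        have := le_hsup F hb (a • v) x x y r (by simpa using hr.1) hy
        rw [← h] at this ⊢
        simpa using this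
      · rw [mul_comm, ← le_div_iff₀ h]
        refine hsup_le F hne _ x r _ hr.1 fun z y hz hy => ?_
        rw [le_div_iff₀ h, mul_comm, ← real_inner_smul_right]
        exact le_hsup F hb _ x z y r hz hy
  · intro v x x' hv hx hx'
    try dsimp only
    set δ := ‖x - x'‖ with hδ
    have hδ0 : 0 ≤ δ := norm_nonneg _
    have hδR : δ ≤ 2 * R := by have := norm_sub_le x x'; linarith
    have h1 : ∫ r in (0:ℝ)..e, hsup F v x r ≤ ∫ r in (0:ℝ)..e, hsup F v x' (r + δ) := by
      refine intervalIntegral.integral_mono_on he.le (hint _ _ _ _ le_rfl he.le) ?_ ?_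
      · apply MonotoneOn.intervalIntegrable
        intro r hr s hs hrs
        rw [Set.uIcc_of_le he.le] at hr hs
        exact hsup_mono F hne hb v x' (add_nonneg hr.1 hδ0) (add_nonneg hs.1 hδ0) (by linarith)
      · intro r hr
        refine hsup_le F hne _ x r _ hr.1 fun z y hz hy => ?_
        refine le_hsup F hb v x' z y _ ?_ hy
        have := norm_sub_le_norm_sub_add_norm_sub z x x'
        linarith
    rw [intervalIntegral.integral_comp_add_right (fun r => hsup F v x' r) δ, zero_add] at h1
    have h2 := intervalIntegral.integral_add_adjacent_intervals
      (hint v x' 0 δ le_rfl hδ0) (hint v x' δ (e + δ) hδ0 (by positivity))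
    have h3 := intervalIntegral.integral_add_adjacent_intervals
      (hint v x' 0 e le_rfl he.le) (hint v x' e (e + δ) he.le (by positivity))
    have h4 : ∫ r in e..(e+δ), hsup F v x' r ≤ ∫ r in e..(e+δ), M := by
      refine intervalIntegral.integral_mono_on (by linarith) (hint _ _ _ _ he.le (by positivity))
        (by simp) ?_
      intro r hr
      have := hup v x' r hx' (he.le.trans hr.1) (by linarith [hr.2])
      rwa [hv, mul_one] at this
    have h5 : ∫ r in (0:ℝ)..δ, (-M) ≤ ∫ r in (0:ℝ)..δ, hsup F v x' r := by
      refine intervalIntegral.integral_mono_on (by linarith) (by simp)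
        (hint _ _ _ _ le_rfl hδ0) ?_
      intro r hr
      have := hlo v x' r hx' hr.1
      rwa [hv, mul_one] at this
    simp only [intervalIntegral.integral_const, smul_eq_mul] at h4 h5
    have h6 : 2 * M * δ ≤ max (2 * M) (M * e) * δ := by gcongr; exact le_max_left _ _
    linarith
  · intro v x hx
    try dsimp only
    have h4 : ∫ r in (0:ℝ)..e, hsup F v x r ≤ ∫ r in (0:ℝ)..e, M * ‖v‖ := by
      refine intervalIntegral.integral_mono_on he.le (hint _ _ _ _ le_rfl he.le)
        (by simp) ?_
      intro r hr
      exact hup v x r hx hr.1 (by linarith [hr.2])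
    simp only [intervalIntegral.integral_const, smul_eq_mul] at h4
    have h6 : M * e * ‖v‖ ≤ max (2 * M) (M * e) * ‖v‖ := by gcongr; exact le_max_right _ _
    linarith
  · intro v x t hv ht
    try dsimp only
    have h4 : ∫ r in (0:ℝ)..e, (hsup F v x r + (-l) * t) ≤
        ∫ r in (0:ℝ)..e, hsup F v (x - t • v) r := by
      refine intervalIntegral.integral_mono_on he.le ((hint _ _ _ _ le_rfl he.le).add (by simp))
        (hint _ _ _ _ le_rfl he.le) ?_
      intro r hr
      rw [← le_sub_iff_add_le]
      refine hsup_le F hne _ x r _ hr.1 fun z y hz hy => ?_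
      obtain ⟨y', hy', hin⟩ := hrosl z (z - t • v) y hy
      have h1 := le_hsup F hb v (x - t • v) (z - t • v) y' r (by simpa using hz) hy'
      rw [sub_sub_cancel, real_inner_smul_right, norm_smul, hv, Real.norm_of_nonneg ht.le,
        inner_sub_left] at hin
      have h2 : ⟪y, v⟫ - ⟪y', v⟫ ≤ l * t := by
        refine le_of_mul_le_mul_left ?_ ht
        linarith
      linarith
    rw [intervalIntegral.integral_add (hint _ _ _ _ le_rfl he.le) (by simp)] at h4
    simp only [intervalIntegral.integral_const, smul_eq_mul] at h4
    linarith
  · intro v hv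
    try dsimp only
    have h4 : ∫ r in (0:ℝ)..e, (-rho) ≤ ∫ r in (0:ℝ)..e, hsup F v 0 r := by
      refine intervalIntegral.integral_mono_on he.le (by simp) (hint _ _ _ _ le_rfl he.le) ?_
      intro r hr
      have h1 := le_hsup F hb v 0 0 y0 r (by simpa using hr.1) hy0
      have h2 := (abs_le.mp (abs_real_inner_le_norm y0 v)).1
      rw [hv, mul_one] at h2
      linarith
    simp only [intervalIntegral.integral_const, smul_eq_mul] at h4
    linarith
end

theorem stmt_0 {d : ℕ}
    (F : EuclideanSpace ℝ (Fin d) → Set (EuclideanSpace ℝ (Fin d)))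
    (hne : ∀ x, (F x).Nonempty) (hcp : ∀ x, IsCompact (F x)) (hcv : ∀ x, Convex ℝ (F x))
    (husc : ∀ x, ∀ ε > 0, ∃ δ > 0, ∀ x', dist x' x < δ →
      ∀ y ∈ F x', Metric.infDist y (F x) < ε)
    (l : ℝ) (hl : l < 0)
    (hrosl : ∀ x x', ∀ y ∈ F x, ∃ y' ∈ F x',
      ⟪y - y', x - x'⟫ ≤ l * ‖x - x'‖ ^ 2) :
    ∃ xb : EuclideanSpace ℝ (Fin d), (0 : EuclideanSpace ℝ (Fin d)) ∈ F xb ∧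
      ‖xb‖ ≤ -(1 / l) * Metric.infDist 0 (F 0) := by
  have : ProperSpace (EuclideanSpace ℝ (Fin d)) := FiniteDimensional.proper ℝ _
  obtain ⟨y0, hy0, hy0d⟩ := (hcp 0).exists_infDist_eq_dist (hne 0) 0
  rw [dist_zero_left] at hy0d
  set rho := Metric.infDist 0 (F 0) with hrho
  have hrho0 : 0 ≤ rho := Metric.infDist_nonneg
  by_cases hu : ∃ u0 : EuclideanSpace ℝ (Fin d), ‖u0‖ = 1
  swap
  · have hall : ∀ y : EuclideanSpace ℝ (Fin d), y = 0 := by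
      intro y
      by_contra hy
      exact hu ⟨‖y‖⁻¹ • y, by
        rw [norm_smul, norm_inv, norm_norm, inv_mul_cancel₀ (norm_ne_zero_iff.mpr hy)]⟩
    refine ⟨0, by rw [← hall y0]; rw [hall y0]; rw [hall y0] at hy0; exact hy0, ?_⟩
    rw [hall y0, norm_zero] at hy0d
    rw [hy0d]; simp
  obtain ⟨u0, hu0⟩ := hu
  have hb := bdd_aux F hne hcp husc
  have hex : ∀ n : ℕ, ∃ x, ‖x‖ ≤ rho / (-l * (1 - 1 / ((n : ℝ) + 2))) ∧
      ∀ v, ‖v‖ = 1 → 0 ≤ hsup F v x (1 / ((n : ℝ) + 1)) := by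
    intro n
    have h1 : 1 / ((n : ℝ) + 2) < 1 := by
      rw [div_lt_one (by positivity)]; have : (0:ℝ) ≤ n := Nat.cast_nonneg n
      linarith
    have h2 : 0 < 1 / ((n : ℝ) + 2) := by positivity
    exact key_aux F hne hb u0 hu0 l hl hrosl _ _ rho
      (mul_pos (by linarith) (by linarith)) (by nlinarith) (by positivity) hrho0 y0 hy0 hy0d.ge
  choose X hX hXv using hex
  have hlim : Tendsto (fun n : ℕ => rho / (-l * (1 - 1 / ((n : ℝ) + 2)))) atTop
      (nhds (rho / (-l * (1 - 0)))) := by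
    have h1 : Tendsto (fun n : ℕ => 1 / ((n : ℝ) + 2)) atTop (nhds 0) := by
      have h := (tendsto_one_div_add_atTop_nhds_zero_nat (𝕜 := ℝ)).comp (tendsto_add_atTop_nat 1)
      refine h.congr fun n => ?_
      simp only [Function.comp_apply]
      push_cast
      ring_nf
    refine tendsto_const_nhds.div (tendsto_const_nhds.mul (tendsto_const_nhds.sub h1)) ?_
    simp only [sub_zero, mul_one]
    linarith
  obtain ⟨B, hB⟩ := hlim.bddAbove_range
  have hXB : ∀ n, X n ∈ closedBall (0 : EuclideanSpace ℝ (Fin d)) B := fun n => by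
    simpa using (hX n).trans (hB ⟨n, rfl⟩)
  obtain ⟨xb, -, φ, hφ, hconv⟩ := (isCompact_closedBall _ _).tendsto_subseq hXB
  refine ⟨xb, ?_, ?_⟩
  · by_contra hnot
    obtain ⟨p, hp, hpd⟩ := (hcp xb).exists_infDist_eq_dist (hne xb) 0
    rw [dist_zero_left] at hpd
    have hp0 : p ≠ 0 := fun h => hnot (h ▸ hp)
    have hpn : 0 < ‖p‖ := norm_pos_iff.mpr hp0
    have hproj : ∀ y ∈ F xb, ‖p‖ ^ 2 ≤ ⟪y, p⟫ := by
      have h1 : ‖(0 : EuclideanSpace ℝ (Fin d)) - p‖ = ⨅ w : F xb, ‖0 - (w : EuclideanSpace ℝ (Fin d))‖ := by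
        rw [zero_sub, norm_neg, ← hpd, Metric.infDist_eq_iInf]
        simp only [dist_eq_norm]
      have h2 := (norm_eq_iInf_iff_real_inner_le_zero (hcv xb) hp).mp h1
      intro y hy
      have h3 := h2 y hy
      rw [zero_sub, inner_neg_left, inner_sub_right, real_inner_self_eq_norm_sq,
        real_inner_comm] at h3
      linarith
    obtain ⟨δ, hδ, hu⟩ := husc xb (‖p‖ / 2) (by positivity)
    have e1 : ∀ᶠ n in atTop, dist (X (φ n)) xb < δ / 2 :=
      (Metric.tendsto_nhds.mp hconv) (δ / 2) (by positivity)
    have e2 : ∀ᶠ n in atTop, 1 / ((φ n : ℝ) + 1) < δ / 2 :=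
      ((tendsto_one_div_add_atTop_nhds_zero_nat (𝕜 := ℝ)).comp hφ.tendsto_atTop).eventually_lt_const
        (by positivity)
    obtain ⟨n, hn1, hn2⟩ := (e1.and e2).exists
    have hv1 : ‖-(‖p‖⁻¹ • p)‖ = 1 := by
      rw [norm_neg, norm_smul, norm_inv, norm_norm, inv_mul_cancel₀ hpn.ne']
    have h1 := hXv (φ n) _ hv1
    have h2 := hsup_le F hne (-(‖p‖⁻¹ • p)) (X (φ n)) (1 / ((φ n : ℝ) + 1)) (-(‖p‖ / 2))
      (by positivity) (by
        intro z y hz hy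
        have hzd : dist z xb < δ := by
          have := dist_triangle z (X (φ n)) xb
          rw [dist_eq_norm z (X (φ n))] at this
          linarith
        obtain ⟨q, hq, hqd⟩ := (infDist_lt_iff (hne xb)).mp (hu z hzd y hy)
        rw [dist_eq_norm] at hqd
        have h3 := hproj q hq
        have h4 := (abs_le.mp (abs_real_inner_le_norm (y - q) p)).1
        rw [inner_sub_left] at h4
        rw [inner_neg_right, real_inner_smul_right, neg_le_neg_iff, inv_mul_eq_div,
          le_div_iff₀ hpn]
        nlinarith)
    linarith
  · have h1 := le_of_tendsto_of_tendsto' (hconv.norm) (hlim.comp hφ.tendsto_atTop)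
      (fun n => hX (φ n))
    refine h1.trans (le_of_eq ?_)
    have : l ≠ 0 := hl.ne
    field_simp
    try ring
end

section
/- If F : ℝ^d → (nonempty compact convex subsets of ℝ^d) is upper semicontinuous and ROSL with constant l < 0, then the inclusion 0 ∈ F(x) has a solution x̄ with |x̄| ≤ -(1/l)·dist(0,F(0)) that additionally satisfies ⟨-Proj(0,F(0)), x̄⟩ ≤ l·|x̄|², where Proj(0,F(0)) is the metric projection of 0 onto F(0). -/
open Metric Filter RealInnerProductSpace

theorem bz_lagr (d : ℕ) (τ : ℝ) (hτ : 0 < τ) : ∃ (t w : Fin (d+1) → ℝ), (∀ j, 0 ≤ t j ∧ t j < τ) ∧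
    (∑ j, w j = 1) ∧ ∀ q : Polynomial ℝ, q.natDegree ≤ d → q.eval 1 = ∑ j, w j * q.eval (t j) := by
  let t : Fin (d+1) → ℝ := fun j => τ * (j / (d+1))
  have hinj : Set.InjOn t (Finset.univ : Finset (Fin (d+1))) := by
    intro a _ b _ h
    have h1 : (a:ℝ) / (d+1) = b/(d+1) := mul_left_cancel₀ hτ.ne' h
    have h2 : (a:ℝ) = b := by field_simp at h1; exact h1
    exact Fin.ext (by exact_mod_cast h2)
  have key : ∀ q : Polynomial ℝ, q.natDegree ≤ d → q.eval 1 = ∑ j, (Lagrange.basis Finset.univ t j).eval 1 * q.eval (t j) := by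
    intro q hq
    have := Lagrange.eq_interpolate (f := q) hinj (by
      simp only [Finset.card_univ, Fintype.card_fin]
      exact lt_of_le_of_lt Polynomial.degree_le_natDegree (by exact_mod_cast Nat.lt_succ_of_le hq))
    conv_lhs => rw [this]
    simp [Lagrange.interpolate_apply, Polynomial.eval_finsetSum, mul_comm]
  refine ⟨t, fun j => (Lagrange.basis Finset.univ t j).eval 1, ?_, ?_, key⟩
  · intro j
    have hj : (j:ℝ) < d+1 := by exact_mod_cast j.2
    refine ⟨by positivity, ?_⟩
    have : (j:ℝ)/(d+1) < 1 := by rw [div_lt_one (by positivity)]; exact hj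
    simp only [t]; nlinarith
  · have := key 1 (by simp)
    simpa using this.symm

theorem bz_poly {d : ℕ} (A : EuclideanSpace ℝ (Fin d) →L[ℝ] EuclideanSpace ℝ (Fin d)) :
    ∃ q : Polynomial ℝ, q.natDegree ≤ d ∧ ∀ t : ℝ, (1 + t • A).det = q.eval t := by
  let b := (EuclideanSpace.basisFun (Fin d) ℝ).toBasis
  let M := LinearMap.toMatrix b b (A : EuclideanSpace ℝ (Fin d) →ₗ[ℝ] EuclideanSpace ℝ (Fin d))
  refine ⟨Matrix.det ((Polynomial.X : Polynomial ℝ) • M.map Polynomial.C + (1 : Matrix (Fin d) (Fin d) ℝ).map Polynomial.C), ?_, ?_⟩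
  · simpa using Polynomial.natDegree_det_X_add_C_le M 1
  · intro t
    rw [← Polynomial.coe_evalRingHom, RingHom.map_det]
    rw [ContinuousLinearMap.det, ← LinearMap.det_toMatrix b]
    congr 1
    have : ((1 + t • A : EuclideanSpace ℝ (Fin d) →L[ℝ] EuclideanSpace ℝ (Fin d)) : EuclideanSpace ℝ (Fin d) →ₗ[ℝ] EuclideanSpace ℝ (Fin d)) = 1 + t • (A : EuclideanSpace ℝ (Fin d) →ₗ[ℝ] EuclideanSpace ℝ (Fin d)) := rfl
    rw [this, map_add, map_smul, LinearMap.toMatrix_one]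
    ext i j
    simp [M, Matrix.one_apply, add_comm]
    split_ifs <;> simp [mul_comm]

theorem bz_detpos {d : ℕ} (A : EuclideanSpace ℝ (Fin d) →L[ℝ] EuclideanSpace ℝ (Fin d)) (t : ℝ)
    (ht : 0 ≤ t) (h : t * ‖A‖ < 1) : 0 < (1 + t • A).det := by
  obtain ⟨q, -, hq⟩ := bz_poly A
  have hne : ∀ s ∈ Set.Icc 0 t, q.eval s ≠ 0 := by
    intro s hs h0
    rw [← hq s] at h0
    have := LinearMap.bot_lt_ker_of_det_eq_zero (f := ((1 + s • A : EuclideanSpace ℝ (Fin d) →L[ℝ] EuclideanSpace ℝ (Fin d)) : EuclideanSpace ℝ (Fin d) →ₗ[ℝ] EuclideanSpace ℝ (Fin d))) h0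
    obtain ⟨x, hx, hx0⟩ := (Submodule.ne_bot_iff _).1 this.ne'
    have hx1 : x + s • A x = 0 := by simpa using hx
    have hx2 : ‖x‖ = s * ‖A x‖ := by
      rw [eq_neg_of_add_eq_zero_left hx1, norm_neg, norm_smul, Real.norm_of_nonneg hs.1]
      congr 2
      rw [← eq_neg_of_add_eq_zero_left hx1]
    have h3 := A.le_opNorm x
    have h4 : 0 < ‖x‖ := norm_pos_iff.2 hx0
    have h5 : s * ‖A‖ < 1 := lt_of_le_of_lt (mul_le_mul_of_nonneg_right hs.2 (norm_nonneg _)) h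
    nlinarith [mul_le_mul_of_nonneg_left h3 hs.1]
  have h0 : q.eval 0 = 1 := by
    rw [← hq 0]; simp [ContinuousLinearMap.det]
  rw [hq t]
  by_contra hc
  push Not at hc
  obtain ⟨s, hs, hs0⟩ := intermediate_value_Icc' ht (q.continuous.continuousOn) (show (0:ℝ) ∈ Set.Icc (q.eval t) (q.eval 0) from ⟨hc, by rw [h0]; norm_num⟩)
  exact hne s hs hs0

theorem bz_bij {d : ℕ} (R : ℝ) (hR : 0 < R)
    (G : EuclideanSpace ℝ (Fin d) → EuclideanSpace ℝ (Fin d)) (K : NNReal)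
    (hL : LipschitzOnWith K G (closedBall 0 R))
    (hS : ∀ x, ‖x‖ = R → G x = 0)
    (hr : ∀ x ∈ closedBall (0 : EuclideanSpace ℝ (Fin d)) R, ‖x + G x‖ = R)
    (t : ℝ) (ht : 0 ≤ t) (ht1 : t ≤ 1) (htK : t * (2 * K) < 1) :
    Set.InjOn (fun x => x + t • G x) (closedBall 0 R) ∧
    (fun x => x + t • G x) '' (closedBall 0 R) = closedBall 0 R := by
  classical
  have hL' : ∀ x ∈ closedBall (0 : EuclideanSpace ℝ (Fin d)) R, ∀ y ∈ closedBall (0 : EuclideanSpace ℝ (Fin d)) R, ‖G x - G y‖ ≤ K * ‖x - y‖ := by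
    intro x hx y hy
    simpa [dist_eq_norm] using hL.dist_le_mul x hx y hy
  have hK0 : (0:ℝ) ≤ K := K.2
  constructor
  · intro x hx y hy hxy
    have h1 : x - y = t • (G y - G x) := by
      have : x + t • G x = y + t • G y := hxy
      rw [smul_sub, sub_eq_sub_iff_add_eq_add, this, add_comm]
    have h2 : ‖x - y‖ ≤ t * (K * ‖x - y‖) := by
      conv_lhs => rw [h1, norm_smul, Real.norm_of_nonneg ht, norm_sub_rev]
      exact mul_le_mul_of_nonneg_left (hL' x hx y hy) ht
    have h3 : ‖x - y‖ = 0 := by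
      have h0 := norm_nonneg (x - y)
      by_contra hne
      have : 0 < ‖x - y‖ := lt_of_le_of_ne h0 (Ne.symm hne)
      nlinarith [mul_nonneg ht hK0]
    exact sub_eq_zero.1 (norm_eq_zero.1 h3)
  · apply Set.Subset.antisymm
    · rintro _ ⟨x, hx, rfl⟩
      have h1 : x + t • G x = (1 - t) • x + t • (x + G x) := by
        rw [smul_add, sub_smul, one_smul]; abel
      have := (convex_closedBall (0 : EuclideanSpace ℝ (Fin d)) R) hx
        (show x + G x ∈ closedBall 0 R by simp [hr x hx]) (sub_nonneg.2 ht1) ht (by ring)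
      simpa only [h1] using this
    · intro y hy
      let g : EuclideanSpace ℝ (Fin d) → EuclideanSpace ℝ (Fin d) := fun x => if ‖x‖ ≤ R then G x else 0
      have hmix : ∀ a b : EuclideanSpace ℝ (Fin d), ‖a‖ ≤ R → R < ‖b‖ → ‖G a‖ ≤ 2 * K * ‖a - b‖ := by
        intro a b ha hb
        have hb0 : 0 < ‖b‖ := hR.trans hb
        have hz : ‖(R / ‖b‖) • b‖ = R := by
          rw [norm_smul, Real.norm_of_nonneg (by positivity)]; field_simp
        have h1 := hL' a (by simpa using ha) ((R / ‖b‖) • b) (by simp only [mem_closedBall, dist_zero_right]; exact hz.le)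
        rw [hS _ hz, sub_zero] at h1
        have h2 : ‖b - (R / ‖b‖) • b‖ = ‖b‖ - R := by
          have : b - (R / ‖b‖) • b = (1 - R / ‖b‖) • b := by rw [sub_smul, one_smul]
          rw [this, norm_smul, Real.norm_of_nonneg (by rw [sub_nonneg, div_le_one hb0]; exact hb.le)]
          field_simp
        have h3 := norm_sub_le_norm_sub_add_norm_sub a b ((R / ‖b‖) • b)
        have h4 := norm_sub_norm_le b a
        rw [norm_sub_rev b a] at h4
        nlinarith
      have hg : ∀ a b, ‖g a - g b‖ ≤ 2 * K * ‖a - b‖ := by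
        intro a b
        have h0 : 0 ≤ (K:ℝ) * ‖a - b‖ := by positivity
        by_cases ha : ‖a‖ ≤ R <;> by_cases hb : ‖b‖ ≤ R <;> simp only [g, ha, hb, if_true, if_false]
        · have := hL' a (by simpa using ha) b (by simpa using hb)
          linarith
        · simpa using hmix a b ha (not_le.1 hb)
        · rw [norm_sub_rev a b]; simpa using hmix b a hb (not_le.1 ha)
        · simp; positivity
      have hc : ContractingWith (⟨t * (2 * K), by positivity⟩ : NNReal) (fun x => y - t • g x) := by
        refine ⟨by exact_mod_cast htK, LipschitzWith.of_dist_le_mul ?_⟩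
        intro a b
        rw [dist_eq_norm, dist_eq_norm]
        have : y - t • g a - (y - t • g b) = t • (g b - g a) := by rw [smul_sub]; abel
        rw [this, norm_smul, Real.norm_of_nonneg ht, norm_sub_rev]
        calc t * ‖g a - g b‖ ≤ t * (2 * K * ‖a - b‖) := mul_le_mul_of_nonneg_left (hg a b) ht
          _ = t * (2 * K) * ‖a - b‖ := by ring
      obtain ⟨x, hx⟩ : ∃ x, y - t • g x = x := ⟨_, hc.fixedPoint_isFixedPt⟩
      have hxy : y = x + t • g x := by nth_rewrite 1 [← hx]; abel
      have hxR : ‖x‖ ≤ R := by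
        by_contra h
        simp only [g, h, if_false, smul_zero, add_zero] at hxy
        rw [← hxy] at h
        exact h (by simpa using hy)
      refine ⟨x, by simpa using hxR, ?_⟩
      simp only [g, hxR, if_true] at hxy
      exact hxy.symm

theorem bz_noretract {d : ℕ} (R : ℝ) (hR : 0 < R)
    (G : EuclideanSpace ℝ (Fin d) → EuclideanSpace ℝ (Fin d))
    (hG : ∀ x ∈ closedBall (0 : EuclideanSpace ℝ (Fin d)) R, ContDiffAt ℝ 1 G x)
    (hS : ∀ x, ‖x‖ = R → G x = 0)
    (hr : ∀ x ∈ closedBall (0 : EuclideanSpace ℝ (Fin d)) R, ∀ᶠ y in nhds x, ‖y + G y‖ = R) : False := by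
  set B := closedBall (0 : EuclideanSpace ℝ (Fin d)) R with hB
  have hBc : IsCompact B := isCompact_closedBall _ _
  have hcont : ContinuousOn (fderiv ℝ G) B := fun x hx =>
    ((hG x hx).continuousAt_fderiv (by norm_num)).continuousWithinAt
  have hdiff : ∀ x ∈ B, DifferentiableAt ℝ G x := fun x hx => (hG x hx).differentiableAt (by norm_num)
  obtain ⟨K0, hK0⟩ := hBc.exists_bound_of_continuousOn hcont
  set K : NNReal := K0.toNNReal with hK
  have hKb : ∀ x ∈ B, ‖fderiv ℝ G x‖ ≤ K := fun x hx => (hK0 x hx).trans (Real.le_coe_toNNReal _)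
  have hL : LipschitzOnWith K G B :=
    Convex.lipschitzOnWith_of_nnnorm_fderiv_le (𝕜 := ℝ) hdiff (fun x hx => by exact_mod_cast hKb x hx)
      (convex_closedBall _ _)
  have hτ : (0:ℝ) < 1 / (2 * K + 1) := by positivity
  obtain ⟨t, w, ht, hw, hq⟩ := bz_lagr d _ hτ
  have htK : ∀ j, t j * (2 * K) < 1 ∧ t j ≤ 1 := by
    intro j
    have h1 := (ht j).2
    rw [lt_div_iff₀ (by positivity)] at h1
    have h2 := (ht j).1
    have h3 : (0:ℝ) ≤ t j * K := mul_nonneg h2 K.2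
    constructor <;> nlinarith
  have hvol : ∀ j, ∫ x in B, (1 + t j • fderiv ℝ G x).det = MeasureTheory.volume.real B := by
    intro j
    obtain ⟨hinj, him⟩ := bz_bij R hR G K hL hS (fun x hx => (hr x hx).self_of_nhds) (t j) (ht j).1 (htK j).2 (htK j).1
    have := MeasureTheory.integral_image_eq_integral_abs_det_fderiv_smul MeasureTheory.volume
      (s := B) (f := fun x => x + t j • G x) (f' := fun x => 1 + t j • fderiv ℝ G x) measurableSet_closedBall
      (fun x hx => ((hasFDerivAt_id x).add ((hdiff x hx).hasFDerivAt.const_smul (t j))).hasFDerivWithinAt)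
      hinj (fun _ => (1:ℝ))
    rw [him] at this
    simp only [smul_eq_mul, mul_one] at this
    rw [MeasureTheory.setIntegral_const] at this
    simp only [smul_eq_mul, mul_one] at this
    rw [this]
    apply MeasureTheory.setIntegral_congr_fun measurableSet_closedBall
    intro x hx
    refine (abs_of_pos (bz_detpos _ _ (ht j).1 ?_)).symm
    have h1 := mul_le_mul_of_nonneg_left (hKb x hx) (ht j).1
    have h2 : (0:ℝ) ≤ t j * K := mul_nonneg (ht j).1 K.2
    linarith [(htK j).1]
  have hdet0 : ∀ x ∈ B, (1 + fderiv ℝ G x).det = 0 := by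
    intro x hx
    by_contra hne
    have hsurj : Function.Surjective ((1 + fderiv ℝ G x : EuclideanSpace ℝ (Fin d) →L[ℝ] EuclideanSpace ℝ (Fin d)) : EuclideanSpace ℝ (Fin d) →ₗ[ℝ] EuclideanSpace ℝ (Fin d)) := by
      have hu : IsUnit (LinearMap.det ((1 + fderiv ℝ G x : EuclideanSpace ℝ (Fin d) →L[ℝ] EuclideanSpace ℝ (Fin d)) : EuclideanSpace ℝ (Fin d) →ₗ[ℝ] EuclideanSpace ℝ (Fin d))) := isUnit_iff_ne_zero.2 hne
      exact (LinearEquiv.ofIsUnitDet (v := (EuclideanSpace.basisFun (Fin d) ℝ).toBasis) (v' := (EuclideanSpace.basisFun (Fin d) ℝ).toBasis) (by rwa [LinearMap.det_toMatrix])).surjective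
    obtain ⟨z, hz⟩ := hsurj (x + G x)
    have hd : HasFDerivAt (fun y => y + G y) (1 + fderiv ℝ G x) x :=
      (hasFDerivAt_id x).add (hdiff x hx).hasFDerivAt
    have hd2 := hd.norm_sq
    have hd3 : HasFDerivAt (fun y => ‖y + G y‖ ^ 2) (0 : EuclideanSpace ℝ (Fin d) →L[ℝ] ℝ) x := by
      refine (hasFDerivAt_const (R ^ 2) x).congr_of_eventuallyEq ?_
      filter_upwards [hr x hx] with y hy
      rw [hy]
    have h4 := congrArg (fun L => L z) (hd2.unique hd3)
    have hz' : (1 + fderiv ℝ G x) z = x + G x := hz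
    have hRR : ‖x + G x‖ = R := (hr x hx).self_of_nhds
    change (2:ℕ) • ⟪x + G x, (1 + fderiv ℝ G x) z⟫ = 0 at h4
    rw [hz', real_inner_self_eq_norm_sq, hRR, nsmul_eq_mul] at h4
    have : 0 < R ^ 2 := by positivity
    push_cast at h4
    linarith
  have hint : ∀ j, MeasureTheory.IntegrableOn (fun x => (1 + t j • fderiv ℝ G x).det) B := by
    intro j
    apply ContinuousOn.integrableOn_compact hBc
    have hcs : ContinuousOn (fun x => t j • fderiv ℝ G x) B := by
      have hcc : Continuous (fun A : EuclideanSpace ℝ (Fin d) →L[ℝ] EuclideanSpace ℝ (Fin d) => t j • A) := continuous_const_smul (t j)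
      exact hcc.comp_continuousOn hcont
    exact ContinuousLinearMap.continuous_det.comp_continuousOn (continuousOn_const.add hcs)
  have hsum : ∀ x ∈ B, ∑ j, w j * (1 + t j • fderiv ℝ G x).det = 0 := by
    intro x hx
    obtain ⟨q, hqd, hqe⟩ := bz_poly (fderiv ℝ G x)
    have := hq q hqd
    rw [← hqe 1, one_smul, hdet0 x hx] at this
    rw [this]
    exact Finset.sum_congr rfl fun j _ => by rw [hqe]
  have h1 : ∫ x in B, ∑ j, w j * (1 + t j • fderiv ℝ G x).det = 0 := by
    rw [MeasureTheory.setIntegral_congr_fun measurableSet_closedBall hsum]; simp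
  rw [MeasureTheory.integral_finsetSum _ (fun j _ => (hint j).const_mul (w j))] at h1
  simp only [MeasureTheory.integral_const_mul, hvol] at h1
  rw [← Finset.sum_mul, hw, one_mul] at h1
  have h2 : 0 < MeasureTheory.volume.real B :=
    ENNReal.toReal_pos (measure_closedBall_pos _ _ hR).ne' hBc.measure_lt_top.ne
  linarith

theorem bz_zero {d : ℕ} (R : ℝ) (hR : 0 < R)
    (v : EuclideanSpace ℝ (Fin d) → EuclideanSpace ℝ (Fin d))
    (hv : ContDiff ℝ 1 v) (hS : ∀ x, ‖x‖ = R → ⟪v x, x⟫ < 0) : ∃ x, ‖x‖ ≤ R ∧ v x = 0 := by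
  by_contra hc
  push Not at hc
  let D : EuclideanSpace ℝ (Fin d) → ℝ := fun x => ⟪v x, x⟫ ^ 2 + ‖v x‖ ^ 2 * (R ^ 2 - ‖x‖ ^ 2)
  let lam : EuclideanSpace ℝ (Fin d) → ℝ := fun x => (⟪v x, x⟫ + Real.sqrt (D x)) / ‖v x‖ ^ 2
  have hDc : ContDiff ℝ 1 D :=
    ((hv.inner ℝ contDiff_id).pow 2).add ((hv.norm_sq ℝ).mul (contDiff_const.sub (contDiff_id.norm_sq ℝ)))
  have hD : ∀ x, ‖x‖ ≤ R → 0 < D x := by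
    intro x hx
    have hv0 : 0 < ‖v x‖ := norm_pos_iff.2 (hc x hx)
    rcases hx.lt_or_eq with h | h
    · have : 0 < R ^ 2 - ‖x‖ ^ 2 := by nlinarith [norm_nonneg x]
      simp only [D]; positivity
    · have := hS x h
      simp only [D, h, sub_self, mul_zero, add_zero]
      exact sq_pos_of_neg this
  apply bz_noretract R hR (fun x => - (lam x • v x))
  · intro x hx
    have hx' : ‖x‖ ≤ R := by simpa using hx
    have hv0 : ‖v x‖ ^ 2 ≠ 0 := by have := norm_pos_iff.2 (hc x hx'); positivity
    exact ((((hv.inner ℝ contDiff_id).contDiffAt.add (hDc.contDiffAt.sqrt (hD x hx').ne')).div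
      (hv.norm_sq ℝ).contDiffAt hv0).smul hv.contDiffAt).neg
  · intro x hx
    have : lam x = 0 := by
      simp only [lam, D, hx, sub_self, mul_zero, add_zero]
      rw [Real.sqrt_sq_eq_abs, abs_of_neg (hS x hx)]
      simp
    simp [this]
  · intro x hx
    have hx' : ‖x‖ ≤ R := by simpa using hx
    filter_upwards [hDc.continuous.continuousAt.eventually (lt_mem_nhds (hD x hx')),
      hv.continuous.continuousAt.eventually (isOpen_ne.mem_nhds (hc x hx'))] with y hy1 hy2
    have hv0 : 0 < ‖v y‖ := norm_pos_iff.2 hy2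
    have hs := Real.sq_sqrt hy1.le
    have : ‖y + -(lam y • v y)‖ ^ 2 = R ^ 2 := by
      rw [← sub_eq_add_neg, norm_sub_sq_real, norm_smul, inner_smul_right, real_inner_comm, mul_pow,
        Real.norm_eq_abs, sq_abs]
      simp only [lam]
      field_simp
      have hs' : √(D y) ^ 2 = ⟪v y, y⟫ ^ 2 + ‖v y‖ ^ 2 * (R ^ 2 - ‖y‖ ^ 2) := hs
      linear_combination hs'
    exact (sq_eq_sq₀ (norm_nonneg _) hR.le).1 this

theorem bz_bdd {d : ℕ}
    (F : EuclideanSpace ℝ (Fin d) → Set (EuclideanSpace ℝ (Fin d)))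
    (hne : ∀ x, (F x).Nonempty) (hcp : ∀ x, IsCompact (F x))
    (husc : ∀ x, ∀ ε > 0, ∃ δ > 0, ∀ x', dist x' x < δ →
      ∀ y ∈ F x', Metric.infDist y (F x) < ε) (R : ℝ) :
    ∃ M > 0, ∀ x, ‖x‖ ≤ R → ∀ y ∈ F x, ‖y‖ ≤ M := by
  have : Bornology.IsBounded (⋃ x ∈ closedBall (0 : EuclideanSpace ℝ (Fin d)) R, F x) := by
    refine (isCompact_closedBall (0 : EuclideanSpace ℝ (Fin d)) R).induction_on
      (p := fun s => Bornology.IsBounded (⋃ x ∈ s, F x)) (by simp) ?_ ?_ ?_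
    · intro s t hst h
      exact h.subset (Set.biUnion_subset_biUnion_left hst)
    · intro s t h1 h2
      rw [Set.biUnion_union]; exact h1.union h2
    · intro x _
      obtain ⟨δ, hδ, h⟩ := husc x 1 one_pos
      refine ⟨ball x δ, mem_nhdsWithin_of_mem_nhds (ball_mem_nhds x hδ), ?_⟩
      refine ((hcp x).isBounded.thickening (δ := 1)).subset ?_
      intro y hy
      simp only [Set.mem_iUnion] at hy
      obtain ⟨x', hx', hy⟩ := hy
      exact (mem_thickening_iff_infDist_lt (hne x)).2 (h x' hx' y hy)
  obtain ⟨M, hM0, hM⟩ := this.exists_pos_norm_le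
  refine ⟨M, hM0, fun x hx y hy => hM y ?_⟩
  simp only [Set.mem_iUnion]
  exact ⟨x, by simpa using hx, hy⟩

theorem stmt_1 {d : ℕ}
    (F : EuclideanSpace ℝ (Fin d) → Set (EuclideanSpace ℝ (Fin d)))
    (hne : ∀ x, (F x).Nonempty) (hcp : ∀ x, IsCompact (F x)) (hcv : ∀ x, Convex ℝ (F x))
    (husc : ∀ x, ∀ ε > 0, ∃ δ > 0, ∀ x', dist x' x < δ →
      ∀ y ∈ F x', Metric.infDist y (F x) < ε)
    (l : ℝ) (hl : l < 0)
    (hrosl : ∀ x x', ∀ y ∈ F x, ∃ y' ∈ F x',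
      ⟪y - y', x - x'⟫ ≤ l * ‖x - x'‖ ^ 2)
    (p : EuclideanSpace ℝ (Fin d)) (hp : p ∈ F 0)
    (hpd : dist (0 : EuclideanSpace ℝ (Fin d)) p = Metric.infDist 0 (F 0)) :
    ∃ xb : EuclideanSpace ℝ (Fin d), (0 : EuclideanSpace ℝ (Fin d)) ∈ F xb ∧
      ‖xb‖ ≤ -(1 / l) * Metric.infDist 0 (F 0) ∧
      ⟪-p, xb⟫ ≤ l * ‖xb‖ ^ 2 := by
  obtain ⟨R0, hR0, hpR⟩ : ∃ R0 : ℝ, 0 ≤ R0 ∧ ‖p‖ = -l * R0 :=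
    ⟨‖p‖ / (-l), div_nonneg (norm_nonneg _) (by linarith), (mul_div_cancel₀ _ (neg_ne_zero.2 hl.ne)).symm⟩
  obtain ⟨M, hM0, hM⟩ := bz_bdd F hne hcp husc (R0 + 2)
  let Φ : EuclideanSpace ℝ (Fin d) → Set (EuclideanSpace ℝ (Fin d)) :=
    fun x => {y | y ∈ F x ∧ ⟪y, x⟫ ≤ l * ‖x‖ ^ 2 + ⟪p, x⟫}
  have hΦ : ∀ x, ∃ y, y ∈ Φ x := by
    intro x
    obtain ⟨y, hy, h⟩ := hrosl 0 x p hp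
    refine ⟨y, hy, ?_⟩
    rw [zero_sub, norm_neg, inner_neg_right, inner_sub_left] at h
    linarith
  have hmain : ∀ ε > 0, ε ≤ 1 / 2 → M * ε < -l / 4 → ∃ x, ‖x‖ ≤ R0 + 1 ∧
      0 ∈ convexHull ℝ (⋃ x' ∈ ball x ε, Φ x') := by
    intro ε hε hε2 hεM
    obtain ⟨v, hv⟩ := exists_contMDiffMap_forall_mem_convex_of_local_const
      (modelWithCornersSelf ℝ (EuclideanSpace ℝ (Fin d))) (n := 1)
      (t := fun x : EuclideanSpace ℝ (Fin d) => convexHull ℝ (⋃ x' ∈ ball x ε, Φ x'))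
      (fun x => convex_convexHull ℝ _) (by
        intro x
        obtain ⟨y, hy⟩ := hΦ x
        refine ⟨y, ?_⟩
        filter_upwards [ball_mem_nhds x hε] with z hz
        apply subset_convexHull
        simp only [Set.mem_iUnion]
        exact ⟨x, mem_ball_comm.1 hz, hy⟩)
    obtain ⟨x, hx, hx0⟩ := bz_zero (R0 + 1) (by linarith) v v.contMDiff.contDiff (by
      intro x hx
      have hsub : convexHull ℝ (⋃ x' ∈ ball x ε, Φ x') ⊆ {y | ⟪x, y⟫ < 0} := by
        apply convexHull_min
        · intro y hy
          simp only [Set.mem_iUnion] at hy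
          obtain ⟨x', hx', hyF, hyi⟩ := hy
          have hx'd : ‖x' - x‖ < ε := by simpa [dist_eq_norm] using hx'
          have h1 : ‖x'‖ ≤ R0 + 2 := by
            have := norm_sub_norm_le x' x
            linarith
          have h2 : R0 + 1 / 2 ≤ ‖x'‖ := by
            have := norm_sub_norm_le x x'
            rw [norm_sub_rev] at this
            linarith
          have h3 := hM x' h1 y hyF
          have h4 : ⟪y, x⟫ = ⟪y, x'⟫ - ⟪y, x' - x⟫ := by rw [inner_sub_right]; ring
          have h5 := neg_le_of_abs_le (abs_real_inner_le_norm y (x' - x))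
          have h6 := real_inner_le_norm p x'
          have h7 : ‖y‖ * ‖x' - x‖ ≤ M * ε := mul_le_mul h3 hx'd.le (norm_nonneg _) hM0.le
          rw [hpR] at h6
          have h8 : 1 / 4 ≤ ‖x'‖ * (‖x'‖ - R0) := by nlinarith
          have h9 : l * (‖x'‖ * (‖x'‖ - R0)) ≤ l * (1/4) := mul_le_mul_of_nonpos_left h8 hl.le
          rw [Set.mem_ofPred_eq, real_inner_comm]
          nlinarith
        · exact convex_halfSpace_lt (innerSL ℝ x).toLinearMap.isLinear 0
      rw [real_inner_comm]
      exact hsub (hv x))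
    exact ⟨x, hx, hx0 ▸ hv x⟩
  obtain ⟨ε0, hε0, hε01, hε0M⟩ : ∃ ε0 : ℝ, 0 < ε0 ∧ ε0 ≤ 1 / 2 ∧ M * ε0 < -l / 4 := by
    refine ⟨min (1/2) (-l / (8 * M)), lt_min (by norm_num) (div_pos (by linarith) (by positivity)), min_le_left _ _, ?_⟩
    calc M * min (1/2) (-l / (8 * M)) ≤ M * (-l / (8 * M)) := mul_le_mul_of_nonneg_left (min_le_right _ _) hM0.le
      _ = -l / 8 := by field_simp
      _ < -l / 4 := by linarith
  have hseq : ∀ n : ℕ, ∃ x, ‖x‖ ≤ R0 + 1 ∧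
      (0 : EuclideanSpace ℝ (Fin d)) ∈ convexHull ℝ (⋃ x' ∈ ball x (ε0 / (n + 1)), Φ x') := by
    intro n
    have h1 : ε0 / (n + 1) ≤ ε0 := div_le_self hε0.le (by linarith [Nat.cast_nonneg (α := ℝ) n])
    exact hmain _ (by positivity) (h1.trans hε01) (lt_of_le_of_lt (mul_le_mul_of_nonneg_left h1 hM0.le) hε0M)
  choose u hu hu0 using hseq
  obtain ⟨xb, hxb, φ, hφ, hlim⟩ := (isCompact_closedBall (0 : EuclideanSpace ℝ (Fin d)) (R0 + 1)).tendsto_subseq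
    (x := u) (fun n => by simpa using hu n)
  have hxbR : ‖xb‖ ≤ R0 + 1 := by simpa using hxb
  have hkey : ∀ η > 0, infDist 0 (F xb) ≤ η ∧ (0:ℝ) ≤ l * ‖xb‖ ^ 2 + ⟪p, xb⟫ + η := by
    intro η hη
    obtain ⟨δ1, hδ1, h1⟩ := husc xb η hη
    have hc : Tendsto (fun x' : EuclideanSpace ℝ (Fin d) => l * ‖x'‖ ^ 2 + ⟪p, x'⟫ + M * ‖x' - xb‖) (nhds xb)
        (nhds (l * ‖xb‖ ^ 2 + ⟪p, xb⟫ + M * ‖xb - xb‖)) := by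
      apply Continuous.tendsto
      fun_prop
    rw [sub_self, norm_zero, mul_zero, add_zero] at hc
    obtain ⟨δ2, hδ2, h2⟩ := Metric.eventually_nhds_iff.1 (hc.eventually (gt_mem_nhds (lt_add_of_pos_right _ hη)))
    set δ := min (min δ1 δ2) 1 with hδ
    have hδ0 : 0 < δ := by positivity
    have hsub : ∀ x' ∈ ball xb δ, Φ x' ⊆ cthickening η (F xb) ∩ {y | ⟪xb, y⟫ ≤ l * ‖xb‖ ^ 2 + ⟪p, xb⟫ + η} := by
      rintro x' hx' y ⟨hyF, hyi⟩
      rw [mem_ball, hδ, lt_min_iff, lt_min_iff] at hx'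
      refine ⟨?_, ?_⟩
      · exact thickening_subset_cthickening _ _ ((mem_thickening_iff_infDist_lt (hne xb)).2 (h1 x' hx'.1.1 y hyF))
      · have h3 := h2 hx'.1.2
        have hx'd : ‖x' - xb‖ < 1 := by simpa [dist_eq_norm] using hx'.2
        have h4 : ‖x'‖ ≤ R0 + 2 := by
          have := norm_sub_norm_le x' xb
          linarith
        have h5 := hM x' h4 y hyF
        have h6 : ⟪y, xb⟫ = ⟪y, x'⟫ - ⟪y, x' - xb⟫ := by rw [inner_sub_right]; ring
        have h7 := neg_le_of_abs_le (abs_real_inner_le_norm y (x' - xb))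
        have h8 : ‖y‖ * ‖x' - xb‖ ≤ M * ‖x' - xb‖ := mul_le_mul_of_nonneg_right h5 (norm_nonneg _)
        rw [Set.mem_ofPred_eq, real_inner_comm]
        linarith
    have hconv : Convex ℝ (cthickening η (F xb) ∩ {y | ⟪xb, y⟫ ≤ l * ‖xb‖ ^ 2 + ⟪p, xb⟫ + η}) :=
      ((hcv xb).cthickening η).inter (convex_halfSpace_le (innerSL ℝ xb).toLinearMap.isLinear _)
    have hε : Tendsto (fun n : ℕ => ε0 / ((φ n : ℝ) + 1)) atTop (nhds 0) := by
      have := (tendsto_one_div_add_atTop_nhds_zero_nat (𝕜 := ℝ)).const_mul ε0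
      simp only [mul_zero, mul_one_div] at this
      exact this.comp hφ.tendsto_atTop
    obtain ⟨n, hn1, hn2⟩ := ((hε.eventually (gt_mem_nhds (half_pos hδ0))).and
      (hlim.eventually (ball_mem_nhds xb (half_pos hδ0)))).exists
    have h0 : (0 : EuclideanSpace ℝ (Fin d)) ∈ cthickening η (F xb) ∩ {y | ⟪xb, y⟫ ≤ l * ‖xb‖ ^ 2 + ⟪p, xb⟫ + η} := by
      refine convexHull_min ?_ hconv (hu0 (φ n))
      intro y hy
      simp only [Set.mem_iUnion] at hy
      obtain ⟨x', hx', hy⟩ := hy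
      refine hsub x' ?_ hy
      have h3 : dist x' (u (φ n)) < ε0 / (φ n + 1) := hx'
      have h4 : dist (u (φ n)) xb < δ / 2 := hn2
      have := dist_triangle x' (u (φ n)) xb
      rw [mem_ball]; linarith
    refine ⟨?_, by simpa using h0.2⟩
    have := h0.1
    rw [(hcp xb).cthickening_eq_biUnion_closedBall hη.le] at this
    simp only [Set.mem_iUnion] at this
    obtain ⟨z, hz, hz'⟩ := this
    exact (infDist_le_dist_of_mem hz).trans hz'
  have hA : infDist 0 (F xb) = 0 := le_antisymm (le_of_forall_pos_le_add fun η hη => by simpa using (hkey η hη).1) infDist_nonneg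
  have hBq : (0:ℝ) ≤ l * ‖xb‖ ^ 2 + ⟪p, xb⟫ := le_of_forall_pos_le_add fun η hη => (hkey η hη).2
  refine ⟨xb, ((hcp xb).isClosed.mem_iff_infDist_zero (hne xb)).2 hA, ?_, ?_⟩
  · rw [← hpd, dist_zero_left, hpR]
    have h1 : -(1 / l) * (-l * R0) = R0 := by have := hl.ne; field_simp
    rw [h1]
    have h2 := real_inner_le_norm p xb
    rw [hpR] at h2
    by_contra hcon
    push Not at hcon
    have h3 : 0 < ‖xb‖ := lt_of_le_of_lt hR0 hcon
    have h4 : 0 < ‖xb‖ * (‖xb‖ - R0) := mul_pos h3 (by linarith)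
    nlinarith [mul_neg_of_neg_of_pos hl h4]
  · rw [inner_neg_left]; linarith
end

section
/- Let F : ℝ^d → (nonempty compact convex subsets of ℝ^d) be upper semicontinuous and ROSL with constant l < 0, and let x̃, ȳ ∈ ℝ^d. Then there exists x̄ with ȳ ∈ F(x̄) satisfying |x̄ - (x̃ + (1/(2l))(ȳ - Proj(ȳ, F(x̃))))| ≤ -(1/(2l))·dist(ȳ, F(x̃)). -/
open Metric Filter RealInnerProductSpace

lemma det_interp {d : ℕ} (δ : ℝ) (hδ : 0 < δ) :
    ∃ c : ℕ → ℝ, ∑ i ∈ Finset.range (d+1), c i = 1 ∧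
      ∀ A : EuclideanSpace ℝ (Fin d) →L[ℝ] EuclideanSpace ℝ (Fin d),
        (ContinuousLinearMap.id ℝ _ + A).det =
          ∑ i ∈ Finset.range (d+1),
            c i * (ContinuousLinearMap.id ℝ _ + (δ * (i / (d+1) : ℝ)) • A).det := by
  classical
  set v : ℕ → ℝ := fun i => δ * (i / (d+1) : ℝ) with hv
  have hd : (0:ℝ) < d + 1 := by positivity
  have hinj : Set.InjOn v (Finset.range (d+1) : Finset ℕ) := by
    intro i _ j _ h
    simp only [hv] at h
    have h1 := mul_left_cancel₀ hδ.ne' h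
    rw [div_left_inj' hd.ne'] at h1
    exact_mod_cast h1
  refine ⟨fun i => (Lagrange.basis (Finset.range (d+1)) v i).eval 1, ?_, ?_⟩
  · rw [← Polynomial.eval_finsetSum, Lagrange.sum_basis hinj (by simp)]
    simp
  · intro A
    let b := (EuclideanSpace.basisFun (Fin d) ℝ).toBasis
    let M := LinearMap.toMatrix b b (A : _ →ₗ[ℝ] _)
    let P : Polynomial ℝ := Matrix.det ((Polynomial.X : Polynomial ℝ) • M.map Polynomial.C + (1 : Matrix (Fin d) (Fin d) ℝ).map Polynomial.C)
    have hP : ∀ t : ℝ, P.eval t = (ContinuousLinearMap.id ℝ _ + t • A).det := by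
      intro t
      have : P.eval t = Matrix.det (t • M + 1) := by
        simp only [P]
        rw [← Polynomial.coe_evalRingHom, RingHom.map_det]
        congr 1
        ext i j
        rcases eq_or_ne i j with rfl | hij
        · simp
          try ring
        · simp [hij]
          try ring
      rw [this, ContinuousLinearMap.det, ← LinearMap.det_toMatrix b]
      congr 1
      rw [add_comm]
      simp [M]
    have hdeg : P.degree < (Finset.range (d+1)).card := by
      have := Polynomial.natDegree_det_X_add_C_le M 1
      rw [Fintype.card_fin] at this
      refine lt_of_le_of_lt Polynomial.degree_le_natDegree ?_
      rw [Finset.card_range]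
      exact_mod_cast Nat.lt_succ_of_le this
    have h1 := Lagrange.eq_interpolate hinj hdeg
    have h2 := congrArg (Polynomial.eval 1) h1
    rw [hP, one_smul] at h2
    rw [h2, Lagrange.interpolate_apply, Polynomial.eval_finsetSum]
    refine Finset.sum_congr rfl fun i _ => ?_
    rw [Polynomial.eval_mul, Polynomial.eval_C, hP, mul_comm]

lemma det_pos_aux {d : ℕ} (A : EuclideanSpace ℝ (Fin d) →L[ℝ] EuclideanSpace ℝ (Fin d))
    (hA : ‖A‖ ≤ 1/2) : 0 < (ContinuousLinearMap.id ℝ _ + A).det := by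
  have hne : ∀ t ∈ Set.Icc (0:ℝ) 1, (ContinuousLinearMap.id ℝ _ + t • A).det ≠ 0 := by
    intro t ht h
    have := LinearMap.bot_lt_ker_of_det_eq_zero h
    obtain ⟨v, hv, hv0⟩ := (Submodule.ne_bot_iff _).1 this.ne'
    have h1 : v + t • A v = 0 := by simpa using hv
    have h2 : ‖v‖ = t * ‖A v‖ := by
      rw [eq_neg_of_add_eq_zero_left h1, norm_neg, norm_smul, Real.norm_of_nonneg ht.1]
      congr 2
      rw [← eq_neg_of_add_eq_zero_left h1]
    have h3 := A.le_opNorm v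
    have h4 : 0 < ‖v‖ := norm_pos_iff.2 hv0
    have h5 : t * ‖A v‖ ≤ 1 * ‖A v‖ := by gcongr; exact ht.2
    nlinarith
  have hcont : Continuous fun t : ℝ => (ContinuousLinearMap.id ℝ _ + t • A).det :=
    ContinuousLinearMap.continuous_det.comp (by fun_prop)
  by_contra hneg
  push Not at hneg
  have h0 : (0:ℝ) ∈ Set.Icc ((ContinuousLinearMap.id ℝ _ + (1:ℝ) • A).det) ((ContinuousLinearMap.id ℝ _ + (0:ℝ) • A).det) := by
    constructor
    · simpa using hneg
    · simp [ContinuousLinearMap.det]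
  obtain ⟨t, ht, h⟩ := intermediate_value_Icc' zero_le_one hcont.continuousOn h0
  exact hne t ht h

lemma lip_ext {E : Type*} [NormedAddCommGroup E] [InnerProductSpace ℝ E] (g : E → E) (R L : ℝ) (hL : 0 ≤ L)
    (hg : ∀ x ∈ closedBall (0:E) R, ∀ y ∈ closedBall (0:E) R, ‖g x - g y‖ ≤ L * ‖x - y‖)
    (hs : ∀ x ∈ sphere (0:E) R, g x = 0) (x y : E) :
    ‖(closedBall (0:E) R).indicator g x - (closedBall (0:E) R).indicator g y‖ ≤ L * ‖x - y‖ := by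
  have key : ∀ x ∈ closedBall (0:E) R, ∀ y ∉ closedBall (0:E) R, ‖g x‖ ≤ L * ‖x - y‖ := by
    intro x hx y hy
    simp only [mem_closedBall, dist_zero_right, not_le] at hx hy
    have hc : ContinuousOn (fun t : ℝ => ‖x + t • (y - x)‖) (Set.Icc 0 1) := by fun_prop
    obtain ⟨t, ht, h⟩ := intermediate_value_Icc zero_le_one hc (show R ∈ _ from by
      simp [hx, hy.le])
    simp only at h
    set w := x + t • (y - x)
    have h1 := hg x (by simpa using hx) w (by simp [h])
    rw [hs w (by simp [h]), sub_zero] at h1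
    refine h1.trans ?_
    gcongr
    have : x - w = t • (x - y) := by simp only [w]; module
    rw [this, norm_smul, Real.norm_of_nonneg ht.1]
    exact mul_le_of_le_one_left (norm_nonneg _) ht.2
  by_cases hx : x ∈ closedBall (0:E) R <;> by_cases hy : y ∈ closedBall (0:E) R
  · simpa [Set.indicator_of_mem hx, Set.indicator_of_mem hy] using hg x hx y hy
  · simpa [Set.indicator_of_mem hx, Set.indicator_of_notMem hy] using key x hx y hy
  · simpa [Set.indicator_of_notMem hx, Set.indicator_of_mem hy, norm_sub_rev x y] using key y hy x hx
  · simp [Set.indicator_of_notMem hx, Set.indicator_of_notMem hy]; positivity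

lemma bij_aux {E : Type*} [NormedAddCommGroup E] [CompleteSpace E] (g : E → E)
    (hg : ∀ x y, ‖g x - g y‖ ≤ 1/2 * ‖x - y‖) : Function.Bijective fun x => x + g x := by
  constructor
  · intro x y h
    simp only at h
    have h1 : x - y = g y - g x := by
      rw [sub_eq_sub_iff_add_eq_add, h, add_comm]
    have h2 := hg y x
    rw [← h1, norm_sub_rev y x] at h2
    have : ‖x - y‖ = 0 := by linarith [norm_nonneg (x-y)]
    exact sub_eq_zero.1 (norm_eq_zero.1 this)
  · intro y
    have hc : ContractingWith (1/2 : NNReal) fun x => y - g x := by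
      refine ⟨by norm_num, LipschitzWith.of_dist_le_mul fun a b => ?_⟩
      rw [dist_eq_norm, dist_eq_norm, sub_sub_sub_cancel_left, norm_sub_rev a b]
      simpa using hg b a
    refine ⟨hc.fixedPoint, ?_⟩
    have : y - g hc.fixedPoint = hc.fixedPoint := hc.fixedPoint_isFixedPt
    simp only
    nth_rewrite 1 [← this]
    abel

lemma no_retract {d : ℕ} (f : EuclideanSpace ℝ (Fin d) → EuclideanSpace ℝ (Fin d)) (R : ℝ) (hR : 0 < R)
    (hf : ∀ x ∈ closedBall (0 : EuclideanSpace ℝ (Fin d)) R, ContDiffAt ℝ 1 f x)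
    (hfR : ∀ x ∈ closedBall (0 : EuclideanSpace ℝ (Fin d)) R, ‖f x‖ = R)
    (hid : ∀ x ∈ sphere (0 : EuclideanSpace ℝ (Fin d)) R, f x = x) : False := by
  set B := closedBall (0 : EuclideanSpace ℝ (Fin d)) R with hB
  have hBc : IsCompact B := isCompact_closedBall _ _
  let I := ContinuousLinearMap.id ℝ (EuclideanSpace ℝ (Fin d))
  let A := fun x => fderiv ℝ f x - I
  let g := fun x => f x - x
  have hgd : ∀ x ∈ B, HasFDerivAt g (A x) x := fun x hx =>
    ((hf x hx).differentiableAt one_ne_zero).hasFDerivAt.sub (hasFDerivAt_id x)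
  have hAc : ContinuousOn A B := by
    intro x hx
    have h1 : ContDiffAt ℝ 0 (fderiv ℝ f) x := (hf x hx).fderiv_right (by norm_num)
    exact (h1.continuousAt.sub continuousAt_const).continuousWithinAt
  obtain ⟨L, hL⟩ := hBc.exists_bound_of_continuousOn hAc
  have hL0 : 0 ≤ L := (norm_nonneg _).trans (hL 0 (by simp [hB, hR.le]))
  have hglip : ∀ x ∈ B, ∀ y ∈ B, ‖g x - g y‖ ≤ L * ‖x - y‖ := fun x hx y hy =>
    (convex_closedBall _ _).norm_image_sub_le_of_norm_hasFDerivWithin_le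
      (fun z hz => (hgd z hz).hasFDerivWithinAt) hL hy hx
  have hG := lip_ext g R L hL0 hglip (fun x hx => by simp [g, hid x hx])
  set G := B.indicator g
  set δ : ℝ := 1 / (2 * (L + 1)) with hδ
  have hδ0 : 0 < δ := by positivity
  have hδL : δ * L ≤ 1/2 := by
    rw [hδ, div_mul_eq_mul_div, div_le_div_iff₀ (by positivity) (by norm_num)]
    linarith
  -- volumes
  have hvol : ∀ t : ℝ, 0 ≤ t → t ≤ δ → ∫ x in B, (I + t • A x).det = MeasureTheory.volume.real B := by
    intro t ht0 htδ
    have htL : t * L ≤ 1/2 := le_trans (by gcongr) hδL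
    have hbij := bij_aux (fun x => t • G x) (fun x y => by
      rw [← smul_sub, norm_smul, Real.norm_of_nonneg ht0]
      calc t * ‖G x - G y‖ ≤ t * (L * ‖x - y‖) := by gcongr; exact hG x y
        _ = (t * L) * ‖x - y‖ := by ring
        _ ≤ _ := by gcongr)
    set φ := fun x => x + t • G x with hφ
    have hout : ∀ x ∉ B, φ x = x := fun x hx => by simp [hφ, G, Set.indicator_of_notMem hx]
    have himg : φ '' B = B := by
      ext y
      constructor
      · rintro ⟨x, hx, rfl⟩
        by_contra h
        have := hbij.1 (hout _ h)
        rw [this] at h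
        exact h hx
      · intro hy
        obtain ⟨x, rfl⟩ := hbij.2 y
        by_cases hx : x ∈ B
        · exact ⟨x, hx, rfl⟩
        · rw [hout x hx] at hy
          exact absurd hy hx
    have hder : ∀ x ∈ B, HasFDerivWithinAt φ (I + t • A x) B x := by
      intro x hx
      have h1 : HasFDerivWithinAt (fun x => x + t • g x) (I + t • A x) B x :=
        ((hasFDerivAt_id x).add ((hgd x hx).const_smul t)).hasFDerivWithinAt
      refine h1.congr (fun y hy => ?_) ?_
      · simp [hφ, G, Set.indicator_of_mem hy]
      · simp [hφ, G, Set.indicator_of_mem hx]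
    have := MeasureTheory.integral_image_eq_integral_abs_det_fderiv_smul MeasureTheory.volume
      hBc.measurableSet hder hbij.1.injOn (fun _ => (1:ℝ))
    rw [himg] at this
    rw [MeasureTheory.setIntegral_const, smul_eq_mul, mul_one] at this
    rw [this]
    refine MeasureTheory.setIntegral_congr_fun hBc.measurableSet fun x hx => ?_
    have hp : 0 < (I + t • A x).det := det_pos_aux _ (by
      rw [norm_smul, Real.norm_of_nonneg ht0]
      exact le_trans (by gcongr; exact hL x hx) htL)
    simp [abs_of_pos hp]
  obtain ⟨c, hc1, hc⟩ := det_interp (d := d) δ hδ0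
  have hone : ∫ x in B, (I + A x).det = MeasureTheory.volume.real B := by
    have h1 : ∀ x, (I + A x).det = ∑ i ∈ Finset.range (d+1), c i * (I + (δ * (i / (d+1) : ℝ)) • A x).det :=
      fun x => hc (A x)
    simp_rw [h1]
    rw [MeasureTheory.integral_finsetSum]
    · have h2 : ∀ i ∈ Finset.range (d+1), ∫ x in B, c i * (I + (δ * (i / (d+1) : ℝ)) • A x).det
          = c i * MeasureTheory.volume.real B := by
        intro i hi
        rw [MeasureTheory.integral_const_mul, hvol _ (by positivity)]
        have : (i:ℝ) / (d+1) ≤ 1 := by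
          rw [div_le_one (by positivity)]
          have := Finset.mem_range.1 hi
          exact_mod_cast this.le
        exact mul_le_of_le_one_right hδ0.le this
      rw [Finset.sum_congr rfl h2, ← Finset.sum_mul, hc1, one_mul]
    · intro i _
      refine ContinuousOn.integrableOn_compact hBc ?_
      refine continuousOn_const.mul ?_
      exact ContinuousLinearMap.continuous_det.comp_continuousOn
        (continuousOn_const.add (hAc.fun_const_smul _))
  have hpos : 0 < MeasureTheory.volume.real B := by
    rw [MeasureTheory.measureReal_def]
    exact ENNReal.toReal_pos (measure_closedBall_pos _ _ hR).ne' hBc.measure_lt_top.ne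
  -- zero determinant on the open ball
  have hzero : ∀ x ∈ ball (0 : EuclideanSpace ℝ (Fin d)) R, (I + A x).det = 0 := by
    intro x hx
    have hxB : x ∈ B := ball_subset_closedBall hx
    have hIA : I + A x = fderiv ℝ f x := by simp [A]
    rw [hIA]
    by_contra hdet
    have hu : IsUnit (LinearMap.det (fderiv ℝ f x : EuclideanSpace ℝ (Fin d) →ₗ[ℝ] EuclideanSpace ℝ (Fin d))) :=
      isUnit_iff_ne_zero.2 hdet
    have hsurj := (LinearMap.equivOfIsUnitDet hu).surjective
    obtain ⟨u, hu'⟩ := hsurj (f x)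
    have hu2 : fderiv ℝ f x u = f x := by simpa using hu'
    have hfd := ((hf x hxB).differentiableAt one_ne_zero).hasFDerivAt
    have h1 := hfd.inner ℝ hfd
    have h2 : HasFDerivAt (fun y => ⟪f y, f y⟫) (0 : EuclideanSpace ℝ (Fin d) →L[ℝ] ℝ) x := by
      refine (hasFDerivAt_const (R^2) x).congr_of_eventuallyEq ?_
      filter_upwards [isOpen_ball.mem_nhds hx] with y hy
      rw [real_inner_self_eq_norm_sq, hfR y (ball_subset_closedBall hy)]
    have h3 := congrArg (fun T => T u) (h1.unique h2)
    simp [hu2, hfR x hxB, hR.ne'] at h3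
  have hae : ∫ x in B, (I + A x).det = 0 := by
    have : ∫ x in B, (I + A x).det = ∫ x in ball (0 : EuclideanSpace ℝ (Fin d)) R, (I + A x).det := by
      refine MeasureTheory.setIntegral_congr_set ?_
      refine (MeasureTheory.ae_eq_of_subset_of_measure_ge ball_subset_closedBall ?_ measurableSet_ball.nullMeasurableSet hBc.measure_lt_top.ne).symm
      rw [MeasureTheory.Measure.addHaar_closedBall _ _ hR.le, MeasureTheory.Measure.addHaar_ball_of_pos _ _ hR]
    rw [this, MeasureTheory.setIntegral_congr_fun measurableSet_ball hzero]
    simp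
  linarith

lemma zero_of_id {d : ℕ} (h : EuclideanSpace ℝ (Fin d) → EuclideanSpace ℝ (Fin d)) (R : ℝ) (hR : 0 < R)
    (hh : ContDiff ℝ 1 h) (hid : ∀ x ∈ sphere (0 : EuclideanSpace ℝ (Fin d)) R, h x = x) :
    ∃ x ∈ closedBall (0 : EuclideanSpace ℝ (Fin d)) R, h x = 0 := by
  by_contra hne
  push Not at hne
  refine no_retract (fun x => (R * ‖h x‖⁻¹) • h x) R hR ?_ ?_ ?_
  · intro x hx
    have h1 := (hh.contDiffAt (x := x)).norm ℝ (hne x hx)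
    exact (contDiffAt_const.mul (h1.inv (norm_ne_zero_iff.2 (hne x hx)))).smul hh.contDiffAt
  · intro x hx
    have := norm_ne_zero_iff.2 (hne x hx)
    rw [norm_smul, Real.norm_of_nonneg (by positivity)]
    field_simp
  · intro x hx
    have h2 : ‖x‖ = R := by simpa using hx
    simp only [hid x hx, h2, mul_inv_cancel₀ hR.ne', one_smul]

lemma zero_of_inward {d : ℕ} (v : EuclideanSpace ℝ (Fin d) → EuclideanSpace ℝ (Fin d)) (a : EuclideanSpace ℝ (Fin d))
    (R : ℝ) (hR : 0 < R)
    (hv : ContDiff ℝ 1 v)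
    (hin : ∀ x, R ≤ ‖x - a‖ → ‖x - a‖ ≤ 2 * R → ⟪v x, x - a⟫ < 0) :
    ∃ x, ‖x - a‖ ≤ R ∧ v x = 0 := by
  let χ : ContDiffBump (0 : EuclideanSpace ℝ (Fin d)) := ⟨R, 2 * R, hR, by linarith⟩
  have hχ : ContDiff ℝ 1 χ := χ.contDiff
  obtain ⟨x, hx, hx0⟩ := zero_of_id (fun x => (1 - χ x) • x - χ x • v (a + x)) (2 * R) (by positivity)
    (by fun_prop) (by
      intro x hx
      have : χ x = 0 := χ.zero_of_le_dist (by simpa [χ] using (mem_sphere.1 hx).ge)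
      simp [this])
  have hxR : ‖x‖ < R := by
    by_contra hcon
    push Not at hcon
    have h1 := hin (a + x) (by simpa using hcon) (by simpa using hx)
    rw [add_sub_cancel_left] at h1
    have h2 := congrArg (fun z => ⟪z, x⟫) hx0
    simp only [inner_sub_left, real_inner_smul_left, inner_zero_left, real_inner_self_eq_norm_sq] at h2
    have h3 := χ.nonneg (x := x)
    have h4 := χ.le_one (x := x)
    have h5 : 0 < ‖x‖^2 := by have := hR.trans_le hcon; positivity
    rcases h3.eq_or_lt with h6 | h6
    · rw [← h6] at h2; linarith
    · nlinarith [mul_pos_of_neg_of_neg (neg_lt_zero.2 h6) h1, mul_nonneg (sub_nonneg.2 h4) h5.le]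
  have h1 : χ x = 1 := χ.one_of_mem_closedBall (by simpa [χ] using hxR.le)
  refine ⟨a + x, by simpa using hxR.le, ?_⟩
  simpa [h1] using hx0

open scoped Manifold ContDiff in
lemma approx_zero {d : ℕ} (s : EuclideanSpace ℝ (Fin d) → EuclideanSpace ℝ (Fin d)) (a : EuclideanSpace ℝ (Fin d))
    (R C : ℝ) (hR : 0 < R)
    (hC : ∀ z, ‖z - a‖ ≤ 2 * R + 1 → ‖s z‖ ≤ C)
    (hin : ∀ z, R - 1 ≤ ‖z - a‖ → ⟪s z, z - a⟫ ≤ -1)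
    (δ : ℝ) (hδ : 0 < δ) (hδ1 : δ ≤ 1) (hδC : C * δ < 1) :
    ∃ x, ‖x - a‖ ≤ R ∧ (0 : EuclideanSpace ℝ (Fin d)) ∈ convexHull ℝ (s '' ball x δ) := by
  obtain ⟨g, hg⟩ := exists_contMDiffMap_forall_mem_convex_of_local_const (n := 1)
    𝓘(ℝ, EuclideanSpace ℝ (Fin d)) (t := fun x => convexHull ℝ (s '' ball x δ))
    (fun x => convex_convexHull _ _) (fun x => ⟨s x, by
      filter_upwards [ball_mem_nhds x hδ] with y hy
      exact subset_convexHull _ _ ⟨x, by rwa [mem_ball_comm], rfl⟩⟩)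
  obtain ⟨x, hx, hx0⟩ := zero_of_inward g a R hR g.contMDiff.contDiff (by
    intro x h1 h2
    have hsub : convexHull ℝ (s '' ball x δ) ⊆ {y | ⟪y, x - a⟫ < 0} := by
      refine convexHull_min ?_ ?_
      · rintro _ ⟨z, hz, rfl⟩
        have hzx : ‖x - z‖ < δ := by rwa [mem_ball_comm, mem_ball, dist_eq_norm] at hz
        have e1 : ‖x - a‖ ≤ ‖x - z‖ + ‖z - a‖ := norm_sub_le_norm_sub_add_norm_sub _ _ _
        have e2 : ‖z - a‖ ≤ ‖z - x‖ + ‖x - a‖ := norm_sub_le_norm_sub_add_norm_sub _ _ _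
        rw [norm_sub_rev z x] at e2
        have e3 := hin z (by linarith)
        have e4 := hC z (by linarith)
        have e5 : ⟪s z, x - z⟫ ≤ C * δ := (real_inner_le_norm _ _).trans (by gcongr; exact (norm_nonneg _).trans e4)
        have e6 : x - a = (z - a) + (x - z) := by abel
        simp only [Set.mem_ofPred_eq]
        rw [e6, inner_add_right]
        linarith
      · have : {y | ⟪y, x - a⟫ < 0} = {y | ⟪x - a, y⟫ < 0} := by
          ext y; simp [real_inner_comm]
        rw [this]
        exact convex_halfSpace_lt (f := fun y => ⟪x - a, y⟫)
          ⟨fun _ _ => inner_add_right _ _ _, fun c y => real_inner_smul_right _ _ _⟩ 0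
    exact hsub (hg x))
  exact ⟨x, hx, hx0 ▸ hg x⟩

lemma limit_zero {d : ℕ} (s : EuclideanSpace ℝ (Fin d) → EuclideanSpace ℝ (Fin d)) (a : EuclideanSpace ℝ (Fin d))
    (R C : ℝ) (hR : 0 < R)
    (hC : ∀ z, ‖z - a‖ ≤ 2 * R + 1 → ‖s z‖ ≤ C)
    (hin : ∀ z, R - 1 ≤ ‖z - a‖ → ⟪s z, z - a⟫ ≤ -1) :
    ∃ x, ‖x - a‖ ≤ R ∧ ∀ K : Set (EuclideanSpace ℝ (Fin d)), Convex ℝ K →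
      (∀ᶠ z in nhds x, s z ∈ K) → (0 : EuclideanSpace ℝ (Fin d)) ∈ K := by
  have hC0 : 0 ≤ C := (norm_nonneg _).trans (hC a (by simp; positivity))
  have hp : ∀ n : ℕ, 0 < 1 / ((C + 1) * ((n:ℝ) + 1)) := fun n => by positivity
  have hle : ∀ n : ℕ, 1 / ((C + 1) * ((n:ℝ) + 1)) ≤ 1 / (C + 1) := fun n => by
    refine one_div_le_one_div_of_le (by positivity) ?_
    have : (0:ℝ) ≤ n := by positivity
    nlinarith
  have hseq : ∀ n : ℕ, ∃ x, ‖x - a‖ ≤ R ∧ (0 : EuclideanSpace ℝ (Fin d)) ∈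
      convexHull ℝ (s '' ball x (1 / ((C + 1) * ((n:ℝ) + 1)))) := fun n => by
    refine approx_zero s a R C hR hC hin _ (hp n) ((hle n).trans ?_) ?_
    · rw [div_le_one (by positivity)]; linarith
    · calc C * _ ≤ C * (1 / (C + 1)) := mul_le_mul_of_nonneg_left (hle n) hC0
        _ < 1 := by rw [mul_one_div, div_lt_one (by positivity)]; linarith
  choose x hxR hx0 using hseq
  obtain ⟨y, hy, φ, hφ, hlim⟩ := (isCompact_closedBall a R).tendsto_subseq
    (x := x) (fun n => by simpa [dist_eq_norm] using hxR n)
  refine ⟨y, by simpa [dist_eq_norm] using hy, fun K hK hev => ?_⟩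
  obtain ⟨ε, hε, hball⟩ := Metric.eventually_nhds_iff_ball.1 hev
  have hd : Tendsto (fun n : ℕ => 1 / ((C + 1) * ((n:ℝ) + 1))) atTop (nhds 0) := by
    have := (tendsto_one_div_add_atTop_nhds_zero_nat (𝕜 := ℝ)).const_mul (1 / (C + 1))
    rw [mul_zero] at this
    refine this.congr fun n => ?_
    rw [one_div_mul_one_div]
  have hd2 := hd.comp hφ.tendsto_atTop
  obtain ⟨n, h1, h2⟩ := ((hd2.eventually_lt_const (half_pos hε)).and
    (hlim.eventually (ball_mem_nhds y (half_pos hε)))).exists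
  refine convexHull_min ?_ hK (hx0 (φ n))
  rintro _ ⟨z, hz, rfl⟩
  refine hball z ?_
  simp only [Function.comp_apply, mem_ball] at h1 h2 hz ⊢
  linarith [dist_triangle z (x (φ n)) y]

theorem stmt_2 {d : ℕ}
    (F : EuclideanSpace ℝ (Fin d) → Set (EuclideanSpace ℝ (Fin d)))
    (hne : ∀ x, (F x).Nonempty) (hcp : ∀ x, IsCompact (F x)) (hcv : ∀ x, Convex ℝ (F x))
    (husc : ∀ x, ∀ ε > 0, ∃ δ > 0, ∀ x', dist x' x < δ →
      ∀ y ∈ F x', Metric.infDist y (F x) < ε)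
    (l : ℝ) (hl : l < 0)
    (hrosl : ∀ x x', ∀ y ∈ F x, ∃ y' ∈ F x',
      ⟪y - y', x - x'⟫ ≤ l * ‖x - x'‖ ^ 2)
    (xt yb : EuclideanSpace ℝ (Fin d))
    (p : EuclideanSpace ℝ (Fin d)) (hp : p ∈ F xt)
    (hpd : dist yb p = Metric.infDist yb (F xt)) :
    ∃ xb : EuclideanSpace ℝ (Fin d), yb ∈ F xb ∧
      ‖xb - (xt + (1 / (2 * l)) • (yb - p))‖ ≤ -(1 / (2 * l)) * Metric.infDist yb (F xt) := by
  have husc' : ∀ x, ∀ ε > 0, ∀ᶠ z in nhds x, ∀ y ∈ F z, y ∈ thickening ε (F x) := by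
    intro x ε hε
    obtain ⟨δ, hδ, h⟩ := husc x ε hε
    filter_upwards [ball_mem_nhds x hδ] with z hz y hy
    exact (mem_thickening_iff_infDist_lt (hne x)).2 (h z hz y hy)
  choose s hsF hs using fun x' => hrosl xt x' p hp
  have hs2 : ∀ z, ⟪s z - yb, z - xt⟫ ≤ l * ‖z - xt‖^2 + ⟪p - yb, z - xt⟫ := by
    intro z
    have h1 := hs z
    rw [norm_sub_rev] at h1
    have h2 : ⟪p - s z, xt - z⟫ = ⟪s z - yb, z - xt⟫ - ⟪p - yb, z - xt⟫ := by
      rw [← inner_sub_left, ← neg_sub z xt, inner_neg_right, ← inner_neg_left]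
      congr 1; abel
    linarith
  -- boundedness
  have hbdd : ∀ r : ℝ, ∃ C, ∀ z ∈ closedBall xt r, ‖s z - yb‖ ≤ C := by
    intro r
    refine (isCompact_closedBall xt r).induction_on (p := fun S => ∃ C, ∀ z ∈ S, ‖s z - yb‖ ≤ C)
      ⟨0, by simp⟩ ?_ ?_ ?_
    · rintro S T hST ⟨C, hC⟩
      exact ⟨C, fun z hz => hC z (hST hz)⟩
    · rintro S T ⟨C, hC⟩ ⟨D, hD⟩
      refine ⟨max C D, ?_⟩
      rintro z (hz | hz)
      · exact (hC z hz).trans (le_max_left _ _)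
      · exact (hD z hz).trans (le_max_right _ _)
    · intro x _
      obtain ⟨C, hC⟩ := ((hcp x).isBounded.thickening (δ := 1)).exists_norm_le
      refine ⟨_, mem_nhdsWithin_of_mem_nhds (husc' x 1 one_pos), C + ‖yb‖, fun z hz => ?_⟩
      exact (norm_sub_le _ _).trans (by gcongr; exact hC _ (hz _ (hsF z)))
  set N : ℝ := 1 + (‖p - yb‖ + 1) / (-l) with hN
  have hl' : 0 < -l := by linarith
  have hN1 : 1 ≤ N := by rw [hN]; have : 0 ≤ (‖p - yb‖ + 1) / (-l) := by positivity
                         linarith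
  have hNl : ‖p - yb‖ + 1 ≤ (-l) * N := by
    have : (-l) * ((‖p - yb‖ + 1) / (-l)) = ‖p - yb‖ + 1 := mul_div_cancel₀ _ hl'.ne'
    rw [hN, mul_add, this]; linarith
  obtain ⟨C, hC⟩ := hbdd (2 * (N + 1) + 1)
  obtain ⟨x, hxR, hx⟩ := limit_zero (fun z => s z - yb) xt (N + 1) C (by linarith)
    (fun z hz => hC z (by simpa [dist_eq_norm] using hz)) (by
      intro z hz
      have h1 : N ≤ ‖z - xt‖ := by linarith
      have h2 := hs2 z
      have h3 := real_inner_le_norm (p - yb) (z - xt)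
      have h4 : (-l) * N ≤ (-l) * ‖z - xt‖ := by gcongr
      have h5 : 0 ≤ ‖z - xt‖ * ((-l) * ‖z - xt‖ - ‖p - yb‖ - 1) :=
        mul_nonneg (norm_nonneg _) (by linarith)
      nlinarith)
  refine ⟨x, ?_, ?_⟩
  · rw [← (hcp x).isClosed.closure_eq, closure_eq_iInter_thickening]
    simp only [Set.mem_iInter]
    intro ε hε
    have := hx ((fun z => yb + z) ⁻¹' thickening ε (F x)) (((hcv x).thickening ε).translate_preimage_right yb) (by
      filter_upwards [husc' x ε hε] with z hz
      simpa using hz _ (hsF z))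
    simpa using this
  · have hq : 0 ≤ l * ‖x - xt‖^2 + ⟪p - yb, x - xt⟫ := by
      refine le_of_forall_pos_le_add fun η hη => ?_
      have hcont : Continuous fun z => l * ‖z - xt‖^2 + ⟪p - yb, z - xt⟫ + C * ‖x - z‖ := by fun_prop
      have hev := (hcont.continuousAt (x := x)).eventually_lt_const
        (u := l * ‖x - xt‖^2 + ⟪p - yb, x - xt⟫ + η) (by simpa using hη)
      have := hx {y | ⟪x - xt, y⟫ ≤ l * ‖x - xt‖^2 + ⟪p - yb, x - xt⟫ + η}
        (convex_halfSpace_le (f := fun y => ⟪x - xt, y⟫)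
          ⟨fun _ _ => inner_add_right _ _ _, fun c y => real_inner_smul_right _ _ _⟩ _) (by
          filter_upwards [hev, ball_mem_nhds x one_pos] with z hz hzb
          have e0 : ‖z - x‖ < 1 := by rwa [mem_ball, dist_eq_norm] at hzb
          have e2 : ‖z - xt‖ ≤ ‖z - x‖ + ‖x - xt‖ := norm_sub_le_norm_sub_add_norm_sub _ _ _
          have e4 := hC z (by rw [mem_closedBall, dist_eq_norm]; linarith)
          have e5 : ⟪s z - yb, x - z⟫ ≤ C * ‖x - z‖ := (real_inner_le_norm _ _).trans (by gcongr)
          have e6 : x - xt = (z - xt) + (x - z) := by abel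
          have e7 : ⟪s z - yb, x - xt⟫ = ⟪s z - yb, z - xt⟫ + ⟪s z - yb, x - z⟫ := by
            rw [← inner_add_right, ← e6]
          have e8 := hs2 z
          change ⟪x - xt, s z - yb⟫ ≤ _
          rw [real_inner_comm]
          linarith)
      simpa using this
    rw [← hpd, dist_eq_norm]
    have hr : 0 ≤ -(1 / (2 * l)) := by
      rw [← one_div_neg_eq_neg_one_div]
      have : 0 < -(2 * l) := by linarith
      positivity
    refine abs_le_of_sq_le_sq' ?_ (by positivity) |>.2
    have e1 : x - (xt + (1 / (2 * l)) • (yb - p)) = (x - xt) + (1 / (2 * l)) • (p - yb) := by module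
    rw [e1, norm_add_sq_real, norm_smul, mul_pow, mul_pow, norm_sub_rev yb p, real_inner_smul_right, real_inner_comm,
      Real.norm_eq_abs, sq_abs, neg_sq]
    have e2 : ‖x - xt‖^2 + 2 * (1 / (2 * l) * ⟪p - yb, x - xt⟫) = (1 / l) * (l * ‖x - xt‖^2 + ⟪p - yb, x - xt⟫) := by
      have := hl.ne
      field_simp
    have e3 : 1 / l ≤ 0 := by rw [one_div]; exact (inv_lt_zero.2 hl).le
    have := mul_nonpos_of_nonpos_of_nonneg e3 hq
    linarith
end

section
/- Let F : ℝ^d → (nonempty compact convex subsets of ℝ^d) be upper semicontinuous, ROSL with constant l < 0, and L-Lipschitz with L < -2l. Given x₀, ȳ ∈ ℝ^d, the sequence x_{n+1} := x_n + (1/(2l))(ȳ - Proj(ȳ, F(x_n))) satisfies dist(x_n, S_F(ȳ)) ≤ (L^{n-1}/|2l|^n)·dist(ȳ, F(x₀)) for all n ≥ 1. -/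
open Metric Filter RealInnerProductSpace

section aux
variable {E : Type*} [NormedAddCommGroup E] [InnerProductSpace ℝ E]

theorem aux_near {F : E → Set E} (hne : ∀ x, (F x).Nonempty) (hcp : ∀ x, IsCompact (F x))
    {L : ℝ} (hlip : ∀ x x', Metric.hausdorffDist (F x) (F x') ≤ L * ‖x - x'‖)
    (a b y : E) (hy : y ∈ F a) : ∃ q ∈ F b, ‖y - q‖ ≤ L * ‖a - b‖ := by
  obtain ⟨q, hq, h⟩ := (hcp b).exists_infDist_eq_dist (hne b) y
  refine ⟨q, hq, ?_⟩
  rw [← dist_eq_norm, ← h]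
  exact (Metric.infDist_le_hausdorffDist_of_mem hy
    (Metric.hausdorffEDist_ne_top_of_nonempty_of_bounded (hne a) (hne b)
      (hcp a).isBounded (hcp b).isBounded)).trans (hlip a b)

theorem aux_infDist {F : E → Set E} (hne : ∀ x, (F x).Nonempty) (hcp : ∀ x, IsCompact (F x))
    {L : ℝ} (hlip : ∀ x x', Metric.hausdorffDist (F x) (F x') ≤ L * ‖x - x'‖)
    (a b y : E) : infDist y (F b) ≤ infDist y (F a) + L * ‖a - b‖ := by
  obtain ⟨q, hq, h⟩ := (hcp a).exists_infDist_eq_dist (hne a) y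
  obtain ⟨r, hr, h'⟩ := aux_near hne hcp hlip a b q hq
  have := infDist_le_dist_of_mem (x := y) hr
  have h2 := dist_triangle y q r
  rw [dist_eq_norm q r] at h2
  linarith

theorem aux_proj {F : E → Set E} (hne : ∀ x, (F x).Nonempty) (hcp : ∀ x, IsCompact (F x))
    (hcv : ∀ x, Convex ℝ (F x)) (y z : E) :
    ∃ R, y - R ∈ F z ∧ ∀ q ∈ F z, ‖R‖ ^ 2 ≤ ⟪y - q, R⟫ := by
  obtain ⟨v, hv, h⟩ := exists_norm_eq_iInf_of_complete_convex (hne z) (hcp z).isComplete (hcv z) y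
  rw [norm_eq_iInf_iff_real_inner_le_zero (hcv z) hv] at h
  refine ⟨y - v, by simpa using hv, fun q hq => ?_⟩
  have := h q hq
  have e : y - q = (y - v) - (q - v) := by abel
  rw [e, inner_sub_left, real_inner_self_eq_norm_sq, real_inner_comm]
  linarith

theorem aux_step {F : E → Set E} (hne : ∀ x, (F x).Nonempty) (hcp : ∀ x, IsCompact (F x))
    {l L : ℝ} (hlip : ∀ x x', Metric.hausdorffDist (F x) (F x') ≤ L * ‖x - x'‖)
    (hrosl : ∀ x x', ∀ y ∈ F x, ∃ y' ∈ F x', ⟪y - y', x - x'⟫ ≤ l * ‖x - x'‖ ^ 2)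
    {μ : ℝ} (hμ : 0 < μ) (z z' y y' R R' : E) (hR : y - R ∈ F z) (hz : z' = z - μ • R)
    (hR' : ∀ q ∈ F z', ‖R'‖ ^ 2 ≤ ⟪y' - q, R'⟫) :
    ‖R'‖ ^ 2 - ‖R‖ ^ 2 ≤ 2 * ⟪y' - y, R'⟫ + (2 * l * μ + L ^ 2 * μ ^ 2) * ‖R'‖ ^ 2 := by
  obtain ⟨P, hP, h1⟩ := aux_near hne hcp hlip z (z' + μ • R') (y - R) hR
  obtain ⟨q, hq, h2⟩ := hrosl (z' + μ • R') z' P hP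
  have h3 := hR' q hq
  have e1 : z - (z' + μ • R') = μ • (R - R') := by rw [hz, smul_sub]; abel
  rw [e1, norm_smul, Real.norm_of_nonneg hμ.le] at h1
  rw [add_sub_cancel_left, inner_smul_right, norm_smul, Real.norm_of_nonneg hμ.le] at h2
  have h2' : ⟪P - q, R'⟫ ≤ l * μ * ‖R'‖ ^ 2 := by
    have : μ * ⟪P - q, R'⟫ ≤ μ * (l * μ * ‖R'‖ ^ 2) := by nlinarith
    exact le_of_mul_le_mul_left this hμ
  have h4 : ⟪y - R - P, R'⟫ ≤ L * (μ * ‖R - R'‖) * ‖R'‖ :=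
    (real_inner_le_norm _ _).trans (mul_le_mul_of_nonneg_right h1 (norm_nonneg _))
  have e2 : ⟪y' - q, R'⟫ = ⟪y' - y, R'⟫ + ⟪R, R'⟫ + ⟪y - R - P, R'⟫ + ⟪P - q, R'⟫ := by
    simp only [← inner_add_left]; congr 1; abel
  have e3 := norm_sub_sq_real R R'
  nlinarith [sq_nonneg (‖R - R'‖ - L * μ * ‖R'‖)]

theorem aux_exists [FiniteDimensional ℝ E] {F : E → Set E}
    (hne : ∀ x, (F x).Nonempty) (hcp : ∀ x, IsCompact (F x))
    (hcv : ∀ x, Convex ℝ (F x))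
    {l L : ℝ} (hlip : ∀ x x', Metric.hausdorffDist (F x) (F x') ≤ L * ‖x - x'‖)
    (hrosl : ∀ x x', ∀ y ∈ F x, ∃ y' ∈ F x', ⟪y - y', x - x'⟫ ≤ l * ‖x - x'‖ ^ 2)
    (hL : 0 ≤ L) {c : ℝ} (hlc : l < c) (hc : c < 0) (x p u : E) (hp : p ∈ F x) :
    ∃ z, p + u ∈ F z ∧ ⟪u, z - x⟫ ≤ c * ‖z - x‖ ^ 2 := by
  obtain ⟨μ, hμ, hμc⟩ : ∃ μ : ℝ, 0 < μ ∧ 2 * l * μ + L ^ 2 * μ ^ 2 ≤ 2 * c * μ := by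
    refine ⟨2 * (c - l) / (L ^ 2 + 1), by have := sub_pos.2 hlc; positivity, ?_⟩
    set μ := 2 * (c - l) / (L ^ 2 + 1) with hm
    have h0 : 0 < μ := by have := sub_pos.2 hlc; positivity
    have : μ * (L ^ 2 + 1) = 2 * (c - l) := by rw [hm]; field_simp
    nlinarith
  choose Rf hRf1 hRf2 using aux_proj hne hcp hcv
  -- approximate solutions
  have approx : ∀ n : ℕ, ∃ z, ⟪u, z - x⟫ ≤ c * ‖z - x‖ ^ 2 ∧
      infDist (p + u) (F z) ≤ ((1 + L * μ) * (‖u‖ / (-(c * μ)))) * (1 / ((n : ℝ) + 1)) := by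
    intro n
    set h : ℝ := 1 / ((n : ℝ) + 1) with hh
    have hpos : 0 < h := by positivity
    let y : ℕ → E := fun k => p + ((k : ℝ) * h) • u
    let z : ℕ → E := fun k => Nat.rec x (fun k zk => zk - μ • Rf (y k) zk) k
    let R : ℕ → E := fun k => Rf (y k) (z k)
    have hz0 : z 0 = x := rfl
    have hzs : ∀ k, z (k + 1) = z k - μ • R k := fun k => rfl
    have hy0 : y 0 = p := by simp [y]
    have hys : ∀ k, y (k + 1) - y k = h • u := by
      intro k
      simp only [y]; push_cast; module
    have hR0 : R 0 = 0 := by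
      have := hRf2 (y 0) (z 0) p hp
      rw [hy0, sub_self, inner_zero_left] at this
      have h0 : ‖Rf p (z 0)‖ = 0 := by nlinarith [norm_nonneg (Rf p (z 0))]
      have := norm_eq_zero.1 h0
      simpa [R, hy0] using this
    have st : ∀ k, ‖R (k + 1)‖ ^ 2 - ‖R k‖ ^ 2 ≤
        2 * h * ⟪u, R (k + 1)⟫ + 2 * c * μ * ‖R (k + 1)‖ ^ 2 := by
      intro k
      have := aux_step hne hcp hlip hrosl hμ (z k) (z (k + 1)) (y k) (y (k + 1)) (R k) (R (k + 1))
        (hRf1 _ _) (hzs k) (hRf2 _ _)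
      rw [hys, real_inner_smul_left] at this
      have h3 := mul_le_mul_of_nonneg_right hμc (sq_nonneg ‖R (k + 1)‖)
      linarith
    have hzsum : ∀ k, z (k + 1) - x = -(μ • ∑ i ∈ Finset.range k, R (i + 1)) := by
      intro k
      induction k with
      | zero => simp [hzs, hR0, hz0]
      | succ k ih =>
        rw [hzs (k + 1), Finset.sum_range_succ, smul_add, neg_add, ← ih]; abel
    have hsum : ∀ k, ‖R k‖ ^ 2 - 2 * c * μ * ∑ i ∈ Finset.range k, ‖R (i + 1)‖ ^ 2 ≤
        2 * h * ⟪u, ∑ i ∈ Finset.range k, R (i + 1)⟫ := by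
      intro k
      induction k with
      | zero => simp [hR0]
      | succ k ih =>
        rw [Finset.sum_range_succ, Finset.sum_range_succ, inner_add_right]
        have := st k
        linarith
    have hcm : 0 < -(c * μ) := by nlinarith
    have hbd : ∀ k, ‖R k‖ ≤ (‖u‖ / (-(c * μ))) * h := by
      intro k
      induction k with
      | zero => rw [hR0, norm_zero]; positivity
      | succ k ih =>
        by_contra! hcon
        have h1 : ‖u‖ * h < ‖R (k + 1)‖ * (-(c * μ)) := by
          rwa [div_mul_eq_mul_div, div_lt_iff₀ hcm] at hcon
        have h2 := real_inner_le_norm u (R (k + 1))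
        have h3 := st k
        have h4 : ‖R k‖ ^ 2 < ‖R (k + 1)‖ ^ 2 :=
          pow_lt_pow_left₀ (ih.trans_lt hcon) (norm_nonneg _) two_ne_zero
        have h5 := mul_le_mul_of_nonneg_left h2 hpos.le
        have h6 := mul_le_mul_of_nonneg_right h1.le (norm_nonneg (R (k + 1)))
        nlinarith
    refine ⟨z (n + 1 + 1), ?_, ?_⟩
    · have h1 := hsum (n + 1)
      rw [hzsum (n + 1)]
      set S := ∑ i ∈ Finset.range (n + 1), R (i + 1) with hS
      set Q := ∑ i ∈ Finset.range (n + 1), ‖R (i + 1)‖ ^ 2 with hQ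
      have h2 : ‖S‖ ^ 2 ≤ ((n : ℝ) + 1) * Q := by
        have a1 : ‖S‖ ≤ ∑ i ∈ Finset.range (n + 1), ‖R (i + 1)‖ := norm_sum_le _ _
        have a2 := sq_sum_le_card_mul_sum_sq (s := Finset.range (n + 1)) (f := fun i => ‖R (i + 1)‖)
        rw [Finset.card_range] at a2
        push_cast at a2
        exact (pow_le_pow_left₀ (norm_nonneg _) a1 2).trans a2
      have h2' : h * ‖S‖ ^ 2 ≤ Q := by
        rw [hh, one_div, inv_mul_le_iff₀ (by positivity)]; exact h2
      have h3 : -(c * μ) * ‖S‖ ^ 2 ≤ ⟪u, S⟫ := by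
        have : h * (-(c * μ) * ‖S‖ ^ 2) ≤ h * ⟪u, S⟫ := by
          nlinarith [mul_le_mul_of_nonneg_left h2' hcm.le, sq_nonneg ‖R (n + 1)‖]
        exact le_of_mul_le_mul_left this hpos
      rw [norm_neg, inner_neg_right, real_inner_smul_right, norm_smul, Real.norm_of_nonneg hμ.le]
      nlinarith [mul_le_mul_of_nonneg_left h3 hμ.le]
    · have h1 := aux_infDist hne hcp hlip (z (n + 1)) (z (n + 1 + 1)) (p + u)
      have hy : y (n + 1) = p + u := by
        simp only [y, hh]; push_cast
        rw [mul_one_div_cancel (by positivity), one_smul]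
      have h2 : infDist (p + u) (F (z (n + 1))) ≤ ‖R (n + 1)‖ := by
        have := infDist_le_dist_of_mem (x := y (n + 1)) (hRf1 (y (n + 1)) (z (n + 1)))
        rw [dist_eq_norm, sub_sub_cancel, hy] at this
        rw [← hy] at this ⊢
        exact this
      have h3 : ‖z (n + 1) - z (n + 1 + 1)‖ = μ * ‖R (n + 1)‖ := by
        rw [hzs (n + 1), sub_sub_cancel, norm_smul, Real.norm_of_nonneg hμ.le]
      rw [h3] at h1
      have h4 := mul_le_mul_of_nonneg_left (hbd (n + 1)) (by positivity : 0 ≤ 1 + L * μ)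
      nlinarith
  -- compactness
  have hcont : Continuous (fun z => infDist (p + u) (F z)) := by
    refine (LipschitzWith.of_le_add_mul ⟨L, hL⟩ (fun a b => ?_)).continuous
    have := aux_infDist hne hcp hlip b a (p + u)
    rw [dist_comm, dist_eq_norm]; exact this
  let K : Set E := {z | ⟪u, z - x⟫ ≤ c * ‖z - x‖ ^ 2}
  have hKc : IsClosed K := isClosed_le (by fun_prop) (by fun_prop)
  have hKb : K ⊆ closedBall x (‖u‖ / (-c)) := by
    intro z hz
    have hz : ⟪u, z - x⟫ ≤ c * ‖z - x‖ ^ 2 := hz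
    rw [mem_closedBall, dist_eq_norm, le_div_iff₀ (by linarith)]
    have h1 := neg_le_of_abs_le (abs_real_inner_le_norm u (z - x))
    by_contra! hcon
    have h0 : 0 < ‖z - x‖ := by
      by_contra! h0
      nlinarith [norm_nonneg u]
    nlinarith
  have hK : IsCompact K := (isCompact_closedBall x _).of_isClosed_subset hKc hKb
  have hKn : K.Nonempty := ⟨x, by simp [K]⟩
  obtain ⟨z, hz, hmin⟩ := hK.exists_isMinOn hKn hcont.continuousOn
  refine ⟨z, ?_, hz⟩
  have hle : infDist (p + u) (F z) ≤ 0 := by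
    have ht := (tendsto_one_div_add_atTop_nhds_zero_nat (𝕜 := ℝ)).const_mul
      ((1 + L * μ) * (‖u‖ / (-(c * μ))))
    rw [mul_zero] at ht
    refine ge_of_tendsto' ht (fun n => ?_)
    obtain ⟨w, hw, hw'⟩ := approx n
    exact (hmin hw).trans hw'
  exact ((hcp z).isClosed.mem_iff_infDist_zero (hne z)).2 (le_antisymm hle infDist_nonneg)

theorem aux_ball [FiniteDimensional ℝ E] {F : E → Set E}
    (hne : ∀ x, (F x).Nonempty) (hcp : ∀ x, IsCompact (F x))
    (hcv : ∀ x, Convex ℝ (F x))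
    {l L : ℝ} (hlip : ∀ x x', Metric.hausdorffDist (F x) (F x') ≤ L * ‖x - x'‖)
    (hrosl : ∀ x x', ∀ y ∈ F x, ∃ y' ∈ F x', ⟪y - y', x - x'⟫ ≤ l * ‖x - x'‖ ^ 2)
    (hL : 0 ≤ L) (hl : l < 0) (x p y : E) (hp : p ∈ F x) :
    {z | y ∈ F z}.Nonempty ∧
    infDist (x + (1 / (2 * l)) • (y - p)) {z | y ∈ F z} ≤ ‖y - p‖ / |2 * l| := by
  have key := fun c (h1 : l < c) (h2 : c < 0) =>
    aux_exists hne hcp hcv hlip hrosl hL h1 h2 x p (y - p) hp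
  simp only [add_sub_cancel] at key
  set u := y - p
  constructor
  · obtain ⟨z, hz, _⟩ := key (l / 2) (by linarith) (by linarith)
    exact ⟨z, hz⟩
  have hsq : infDist (x + (1 / (2 * l)) • u) {z | y ∈ F z} ^ 2 ≤ (‖u‖ / |2 * l|) ^ 2 := by
    have ht : Tendsto (fun c : ℝ => (‖u‖ / |2 * l|) ^ 2 + (1 - c / l) * (‖u‖ / (-c)) ^ 2)
        (nhdsWithin l (Set.Ioi l)) (nhds ((‖u‖ / |2 * l|) ^ 2)) := by
      have hc : ContinuousAt
          (fun c : ℝ => (‖u‖ / |2 * l|) ^ 2 + (1 - c / l) * (‖u‖ / (-c)) ^ 2) l := by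
        have : -l ≠ 0 := by linarith
        fun_prop (disch := assumption)
      have h := hc.tendsto
      simp only [div_self hl.ne, sub_self, zero_mul, add_zero] at h
      exact h.mono_left nhdsWithin_le_nhds
    refine ge_of_tendsto ht ?_
    filter_upwards [Ioo_mem_nhdsGT hl] with c hc
    obtain ⟨z, hz, hin⟩ := key c hc.1 hc.2
    have h1 : infDist (x + (1 / (2 * l)) • u) {z | y ∈ F z} ≤ ‖(z - x) - (1 / (2 * l)) • u‖ := by
      have := infDist_le_dist_of_mem (x := x + (1 / (2 * l)) • u)
        (show z ∈ {z | y ∈ F z} from hz)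
      rwa [dist_comm, dist_eq_norm, ← sub_sub] at this
    refine (pow_le_pow_left₀ infDist_nonneg h1 2).trans ?_
    set D := z - x
    have hD : ‖D‖ ≤ ‖u‖ / (-c) := by
      rw [le_div_iff₀ (by linarith [hc.2])]
      have h1 := neg_le_of_abs_le (abs_real_inner_le_norm u D)
      have hc2 := hc.2
      by_contra! hcon
      have h0 : 0 < ‖D‖ := by
        by_contra! h0
        nlinarith [norm_nonneg u]
      nlinarith
    have hcl : 0 ≤ 1 - c / l := by
      rw [sub_nonneg, div_le_one_of_neg hl]; exact hc.1.le
    have h2 := mul_le_mul_of_nonneg_left (pow_le_pow_left₀ (norm_nonneg D) hD 2) hcl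
    have h3 : -(⟪u, D⟫ / l) ≤ -(c / l * ‖D‖ ^ 2) := by
      have := div_le_div_of_nonpos_of_le hl.le hin
      rw [mul_div_right_comm] at this
      linarith
    rw [norm_sub_sq_real, real_inner_smul_right, norm_smul, mul_pow, div_pow, sq_abs,
      Real.norm_eq_abs, sq_abs, real_inner_comm]
    have e1 : 2 * (1 / (2 * l) * ⟪u, D⟫) = ⟪u, D⟫ / l := by field_simp
    have e2 : (1 / (2 * l)) ^ 2 * ‖u‖ ^ 2 = ‖u‖ ^ 2 / (2 * l) ^ 2 := by field_simp
    rw [e1, e2]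
    linarith
  exact abs_le_of_sq_le_sq' hsq (by positivity) |>.2

end aux

theorem stmt_5 {d : ℕ}
    (F : EuclideanSpace ℝ (Fin d) → Set (EuclideanSpace ℝ (Fin d)))
    (hne : ∀ x, (F x).Nonempty) (hcp : ∀ x, IsCompact (F x)) (hcv : ∀ x, Convex ℝ (F x))
    (husc : ∀ x, ∀ ε > 0, ∃ δ > 0, ∀ x', dist x' x < δ →
      ∀ y ∈ F x', Metric.infDist y (F x) < ε)
    (l L : ℝ) (hl : l < 0) (hL : L < -(2 * l))
    (hrosl : ∀ x x', ∀ y ∈ F x, ∃ y' ∈ F x',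
      ⟪y - y', x - x'⟫ ≤ l * ‖x - x'‖ ^ 2)
    (hlip : ∀ x x', Metric.hausdorffDist (F x) (F x') ≤ L * ‖x - x'‖)
    (yb : EuclideanSpace ℝ (Fin d))
    (x p : ℕ → EuclideanSpace ℝ (Fin d))
    (hp : ∀ n, p n ∈ F (x n) ∧ dist yb (p n) = Metric.infDist yb (F (x n)))
    (hx : ∀ n, x (n + 1) = x n + (1 / (2 * l)) • (yb - p n)) :
    ∀ n, 1 ≤ n →
      Metric.infDist (x n) {z | yb ∈ F z} ≤
        (L ^ (n - 1) / |2 * l| ^ n) * Metric.infDist yb (F (x 0)) := by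
  rcases lt_or_ge L 0 with hL0 | hL0
  · have hsub : ∀ a b : EuclideanSpace ℝ (Fin d), a = b := by
      intro a b
      have h1 := (Metric.hausdorffDist_nonneg (s := F a) (t := F b)).trans (hlip a b)
      by_contra hab
      have := norm_pos_iff.2 (sub_ne_zero.2 hab)
      nlinarith
    intro n _
    have h0 : ∀ a, yb ∈ F a := fun a => by
      obtain ⟨q, hq⟩ := hne a
      rw [hsub yb q]; exact hq
    rw [infDist_zero_of_mem (h0 (x 0)), infDist_zero_of_mem (show x n ∈ {z | yb ∈ F z} from h0 _),
      mul_zero]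
  have hb : ∀ n, {z | yb ∈ F z}.Nonempty ∧
      infDist (x (n + 1)) {z | yb ∈ F z} ≤ infDist yb (F (x n)) / |2 * l| := by
    intro n
    have := aux_ball hne hcp hcv hlip hrosl hL0 hl (x n) (p n) yb (hp n).1
    rw [← hx n, ← dist_eq_norm, (hp n).2] at this
    exact this
  have hS := (hb 0).1
  have hF : ∀ w, infDist yb (F w) ≤ L * infDist w {z | yb ∈ F z} := by
    intro w
    refine le_of_forall_pos_le_add (fun ε hε => ?_)
    obtain ⟨z, hz, hzd⟩ := (infDist_lt_iff hS (x := w) (r := infDist w {z | yb ∈ F z} + ε / (L + 1))).1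
      (by have : 0 < ε / (L + 1) := by positivity
          linarith)
    have h1 := aux_infDist hne hcp hlip z w yb
    rw [infDist_zero_of_mem (show yb ∈ F z from hz), ← dist_eq_norm, dist_comm] at h1
    have h2 := mul_le_mul_of_nonneg_left hzd.le hL0
    have h3 : L * (ε / (L + 1)) ≤ ε := by
      rw [← mul_div_assoc, div_le_iff₀ (by positivity)]
      nlinarith
    linarith
  intro n hn
  obtain ⟨m, rfl⟩ := Nat.exists_eq_add_of_le' hn
  clear hn
  have hpos : 0 < |2 * l| := abs_pos.2 (by linarith)
  rw [Nat.add_sub_cancel]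
  induction m with
  | zero =>
    refine (hb 0).2.trans (le_of_eq ?_)
    simp; ring
  | succ m ih =>
    refine (hb (m + 1)).2.trans ?_
    rw [div_le_iff₀ hpos]
    refine (hF _).trans ((mul_le_mul_of_nonneg_left ih hL0).trans (le_of_eq ?_))
    field_simp
    ring
end

section
/- Geometric estimate: let l < 0 < L with L ≤ -√2·l, let v ∈ ℝ^d with v ≠ 0, and let x̄ be a point with |x̄ - v/(2l)| ≤ -|v|/(2l) and |x̄| ≥ |v|/L. Then |x̄ - (l/L²)·v| ≤ (√(L² - l²)/L²)·|v|. -/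
theorem stmt_18 {d : ℕ} (l L : ℝ) (hl : l < 0) (hL : 0 < L)
    (hL2 : L ≤ -(Real.sqrt 2 * l))
    (v : EuclideanSpace ℝ (Fin d)) (hv : v ≠ 0)
    (xb : EuclideanSpace ℝ (Fin d))
    (h1 : ‖xb - (1 / (2 * l)) • v‖ ≤ -(1 / (2 * l)) * ‖v‖)
    (h2 : ‖v‖ / L ≤ ‖xb‖) :
    ‖xb - (l / L ^ 2) • v‖ ≤ (Real.sqrt (L ^ 2 - l ^ 2) / L ^ 2) * ‖v‖ := by
  have key : ∀ c : ℝ, ‖xb - c • v‖ ^ 2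
      = ‖xb‖ ^ 2 - 2 * c * inner ℝ xb v + c ^ 2 * ‖v‖ ^ 2 := by
    intro c
    rw [norm_sub_sq_real, inner_smul_right, norm_smul, mul_pow, Real.norm_eq_abs, sq_abs]
    ring
  have hLL : L ^ 2 ≤ 2 * l ^ 2 := by
    have h := pow_le_pow_left₀ hL.le hL2 2
    have h3 : (Real.sqrt 2) ^ 2 = 2 := Real.sq_sqrt (by norm_num)
    calc L ^ 2 ≤ _ := h
      _ = (Real.sqrt 2) ^ 2 * l ^ 2 := by ring
      _ = _ := by rw [h3]
  have h1' := pow_le_pow_left₀ (norm_nonneg _) h1 2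
  rw [key] at h1'
  have h2' := pow_le_pow_left₀ (by positivity) h2 2
  have e := key (l / L ^ 2)
  generalize inner ℝ xb v = s at *
  have hs : l ^ 2 * ‖xb‖ ^ 2 ≤ l * s := by
    have h4 : ‖xb‖ ^ 2 - s / l ≤ 0 := by
      have : 2 * (1 / (2 * l)) * s = s / l := by field_simp
      rw [this] at h1'
      nlinarith
    have h5 : l ^ 2 * (‖xb‖ ^ 2 - s / l) = l ^ 2 * ‖xb‖ ^ 2 - l * s := by
      field_simp [hl.ne]
    nlinarith [mul_nonpos_of_nonneg_of_nonpos (sq_nonneg l) h4]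
  have h2'' : ‖v‖ ^ 2 ≤ L ^ 2 * ‖xb‖ ^ 2 := by
    rw [div_pow, div_le_iff₀ (by positivity)] at h2'
    linarith
  have main : (L ^ 2 * ‖xb - (l / L ^ 2) • v‖) ^ 2 ≤ (L ^ 2 - l ^ 2) * ‖v‖ ^ 2 := by
    have : (L ^ 2 * ‖xb - (l / L ^ 2) • v‖) ^ 2
        = L ^ 4 * ‖xb‖ ^ 2 - 2 * L ^ 2 * (l * s) + l ^ 2 * ‖v‖ ^ 2 := by
      rw [mul_pow, e]; field_simp
    rw [this]
    have a := mul_le_mul_of_nonneg_left hs (sq_nonneg L)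
    have b := mul_le_mul_of_nonneg_left h2'' (sub_nonneg.2 hLL)
    linarith
  have f := Real.abs_le_sqrt main
  rw [Real.sqrt_mul' _ (sq_nonneg _), Real.sqrt_sq (norm_nonneg _)] at f
  rw [div_mul_eq_mul_div, le_div_iff₀ (by positivity)]
  linarith [le_abs_self (L ^ 2 * ‖xb - (l / L ^ 2) • v‖)]
end
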